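/- arXiv:2303.10525 — 7 statements merged into one kernel-verified Lean document; each statement's English description precedes it below -/
import Mathlib

section
/- Let X be a measurable space, let P0 and Pθ be probability measures on X, and let D be a map from pairs of probability measures on X to [0,∞] such that Q ↦ D(Q, P0) is convex, i.e. D((1−λ)Q1 + λQ2, P0) ≤ (1−λ)D(Q1, P0) + λD(Q2, P0) for all probability measures Q1, Q2 and all λ ∈ [0,1]. Let 0 ≤ ε0 < ε and α > 0. Then 0 ≤ I_ε(θ) − I_{ε+α}(θ) ≤ (α/(ε − ε0 + α)) · I_{ε0}(θ), where the inequalities are interpreted in the extended reals. If moreover α ≤ ε − ε0, then also 0 ≤ I_{ε−α}(θ) − I_ε(θ) ≤ (α/(ε − ε0)) · I_{ε0}(θ). -/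
open MeasureTheory ENNReal
open scoped Classical

/-- Kullback–Leibler divergence `KL(Q|P) = ∫ log (dQ/dP) dQ` if `Q ≪ P` (and the integral
exists), and `∞` otherwise.  For probability measures the negative part of the integrand is
always integrable, so non-integrability corresponds to the value `∞`. -/
noncomputable def KLdiv {X : Type*} [MeasurableSpace X] (Q P : Measure X) : ℝ≥0∞ :=
  if Q ≪ P ∧ Integrable (fun x => Real.log (Q.rnDeriv P x).toReal) Q
  then ENNReal.ofReal (∫ x, Real.log (Q.rnDeriv P x).toReal ∂Q) else ⊤

/-- The optimistic Kullback–Leibler function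
`I_r(θ) = inf { KL(Q|Pθ) : Q a probability measure with D(Q, P0) ≤ r }`. -/
noncomputable def OKL {X : Type*} [MeasurableSpace X]
    (D : Measure X → Measure X → ℝ≥0∞) (P0 Pθ : Measure X) (r : ℝ) : ℝ≥0∞ :=
  ⨅ Q ∈ {Q : Measure X | IsProbabilityMeasure Q ∧ D Q P0 ≤ ENNReal.ofReal r}, KLdiv Q Pθ

theorem KLdiv_eq_klDiv {X : Type*} [MeasurableSpace X] (Q P : Measure X)
    [IsProbabilityMeasure Q] [IsProbabilityMeasure P] :
    KLdiv Q P = InformationTheory.klDiv Q P := by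
  by_cases h : Q ≪ P ∧ Integrable (fun x => Real.log (Q.rnDeriv P x).toReal) Q
  · rw [KLdiv, if_pos h, InformationTheory.klDiv_of_ac_of_integrable h.1 h.2]
    simp [llr_def]
  · rw [KLdiv, if_neg h, eq_comm, InformationTheory.klDiv_eq_top_iff]
    exact fun h1 h2 => h ⟨h1, h2⟩

/-- The Kullback–Leibler divergence is convex in its first argument. -/
theorem klDiv_convex_left {X : Type*} [MeasurableSpace X] (Q1 Q2 P : Measure X)
    [IsFiniteMeasure Q1] [IsFiniteMeasure Q2] [IsFiniteMeasure P] {a b : ℝ}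
    (ha : 0 ≤ a) (hb : 0 ≤ b) (hab : a + b = 1) :
    InformationTheory.klDiv (ENNReal.ofReal a • Q1 + ENNReal.ofReal b • Q2) P ≤
      ENNReal.ofReal a * InformationTheory.klDiv Q1 P +
        ENNReal.ofReal b * InformationTheory.klDiv Q2 P := by
  rcases ha.eq_or_lt with rfl | ha'
  · obtain rfl : b = 1 := by linarith
    simp
  rcases hb.eq_or_lt with rfl | hb'
  · obtain rfl : a = 1 := by linarith
    simp
  by_cases h1 : Q1 ≪ P
  swap
  · simp [InformationTheory.klDiv_of_not_ac h1, ENNReal.mul_top, ha']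
  by_cases h2 : Q2 ≪ P
  swap
  · simp [InformationTheory.klDiv_of_not_ac h2, ENNReal.mul_top, hb']
  have : IsFiniteMeasure (ENNReal.ofReal a • Q1) := Measure.smul_finite _ ENNReal.ofReal_ne_top
  have : IsFiniteMeasure (ENNReal.ofReal b • Q2) := Measure.smul_finite _ ENNReal.ofReal_ne_top
  have hac : ENNReal.ofReal a • Q1 + ENNReal.ofReal b • Q2 ≪ P :=
    (h1.smul_left _).add_left (h2.smul_left _)
  rw [InformationTheory.klDiv_eq_lintegral_klFun_of_ac hac,
    InformationTheory.klDiv_eq_lintegral_klFun_of_ac h1,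
    InformationTheory.klDiv_eq_lintegral_klFun_of_ac h2,
    ← lintegral_const_mul' _ _ ENNReal.ofReal_ne_top,
    ← lintegral_const_mul' _ _ ENNReal.ofReal_ne_top, ← lintegral_add_left]
  swap
  · exact ((InformationTheory.measurable_klFun.comp
      (Measure.measurable_rnDeriv _ _).ennreal_toReal).ennreal_ofReal).const_mul _
  refine lintegral_mono_ae ?_
  filter_upwards [Measure.rnDeriv_add' (ENNReal.ofReal a • Q1) (ENNReal.ofReal b • Q2) P,
    Measure.rnDeriv_smul_left_of_ne_top' Q1 P (r := ENNReal.ofReal a) ENNReal.ofReal_ne_top,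
    Measure.rnDeriv_smul_left_of_ne_top' Q2 P (r := ENNReal.ofReal b) ENNReal.ofReal_ne_top,
    Measure.rnDeriv_ne_top Q1 P, Measure.rnDeriv_ne_top Q2 P] with x hx hx1 hx2 ht1 ht2
  have hval : ((ENNReal.ofReal a • Q1 + ENNReal.ofReal b • Q2).rnDeriv P x).toReal =
      a * (Q1.rnDeriv P x).toReal + b * (Q2.rnDeriv P x).toReal := by
    rw [hx, Pi.add_apply, hx1, hx2, Pi.smul_apply, Pi.smul_apply, smul_eq_mul, smul_eq_mul,
      ENNReal.toReal_add (ENNReal.mul_ne_top ENNReal.ofReal_ne_top ht1)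
        (ENNReal.mul_ne_top ENNReal.ofReal_ne_top ht2),
      ENNReal.toReal_mul, ENNReal.toReal_mul, ENNReal.toReal_ofReal ha, ENNReal.toReal_ofReal hb]
  rw [hval, ← ENNReal.ofReal_mul ha, ← ENNReal.ofReal_mul hb, ← ENNReal.ofReal_add
    (mul_nonneg ha (InformationTheory.klFun_nonneg ENNReal.toReal_nonneg))
    (mul_nonneg hb (InformationTheory.klFun_nonneg ENNReal.toReal_nonneg))]
  exact ENNReal.ofReal_le_ofReal (InformationTheory.convexOn_klFun.2
    ENNReal.toReal_nonneg ENNReal.toReal_nonneg ha hb hab)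

theorem OKL_antitone {X : Type*} [MeasurableSpace X] (D : Measure X → Measure X → ℝ≥0∞)
    (P0 Pθ : Measure X) : Antitone (OKL D P0 Pθ) := fun _ _ h =>
  biInf_mono fun _ hQ => ⟨hQ.1, hQ.2.trans (ENNReal.ofReal_le_ofReal h)⟩

theorem OKL_le_add_mul {X : Type*} [MeasurableSpace X]
    (P0 Pθ : Measure X) [IsProbabilityMeasure Pθ]
    (D : Measure X → Measure X → ℝ≥0∞)
    (hconv : ∀ Q1 Q2 : Measure X, IsProbabilityMeasure Q1 → IsProbabilityMeasure Q2 →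
      ∀ lam : ℝ, 0 ≤ lam → lam ≤ 1 →
      D (ENNReal.ofReal (1 - lam) • Q1 + ENNReal.ofReal lam • Q2) P0 ≤
        ENNReal.ofReal (1 - lam) * D Q1 P0 + ENNReal.ofReal lam * D Q2 P0)
    {r s lam : ℝ} (hr : 0 ≤ r) (hs : 0 ≤ s) (hlam : 0 < lam) (hlam1 : lam ≤ 1) :
    OKL D P0 Pθ ((1 - lam) * r + lam * s) ≤
      OKL D P0 Pθ r + ENNReal.ofReal lam * OKL D P0 Pθ s := by
  have h0 : ENNReal.ofReal lam ≠ 0 := by simpa using hlam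
  have hlam' : 0 ≤ 1 - lam := sub_nonneg.2 hlam1
  rw [OKL.eq_def D P0 Pθ r, OKL.eq_def D P0 Pθ s]
  simp only [ENNReal.iInf_add, ENNReal.add_iInf, ENNReal.mul_iInf_of_ne h0 ENNReal.ofReal_ne_top]
  refine le_iInf₂ fun Q2 hQ2 => le_iInf₂ fun Q1 hQ1 => ?_
  obtain ⟨_, hD1⟩ := hQ1
  obtain ⟨_, hD2⟩ := hQ2
  have hQ : IsProbabilityMeasure (ENNReal.ofReal (1 - lam) • Q1 + ENNReal.ofReal lam • Q2) :=
    ⟨by simp [← ENNReal.ofReal_add hlam' hlam.le]⟩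
  refine (iInf₂_le (ENNReal.ofReal (1 - lam) • Q1 + ENNReal.ofReal lam • Q2)
    ⟨hQ, (hconv Q1 Q2 inferInstance inferInstance lam hlam.le hlam1).trans ?_⟩).trans ?_
  swap
  · rw [ENNReal.ofReal_add (mul_nonneg hlam' hr) (mul_nonneg hlam.le hs),
      ENNReal.ofReal_mul hlam', ENNReal.ofReal_mul hlam.le]
    gcongr
  · rw [KLdiv_eq_klDiv, KLdiv_eq_klDiv, KLdiv_eq_klDiv]
    refine (klDiv_convex_left Q1 Q2 Pθ hlam' hlam.le (by ring)).trans ?_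
    gcongr
    exact mul_le_of_le_one_left' (ENNReal.ofReal_le_one.2 (by linarith))

/-- Continuity of the OKL function in the coarsening radius (Lemma on OKL continuity):
if `Q ↦ D(Q, P0)` is convex, `0 ≤ ε0 < ε` and `α > 0`, then
`0 ≤ I_ε(θ) − I_{ε+α}(θ) ≤ (α/(ε−ε0+α)) I_{ε0}(θ)`, and if moreover `α ≤ ε − ε0` then also
`0 ≤ I_{ε−α}(θ) − I_ε(θ) ≤ (α/(ε−ε0)) I_{ε0}(θ)` (in the extended reals). -/
theorem stmt0 {X : Type*} [MeasurableSpace X]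
    (P0 Pθ : Measure X) [IsProbabilityMeasure P0] [IsProbabilityMeasure Pθ]
    (D : Measure X → Measure X → ℝ≥0∞)
    (hconv : ∀ Q1 Q2 : Measure X, IsProbabilityMeasure Q1 → IsProbabilityMeasure Q2 →
      ∀ lam : ℝ, 0 ≤ lam → lam ≤ 1 →
      D (ENNReal.ofReal (1 - lam) • Q1 + ENNReal.ofReal lam • Q2) P0 ≤
        ENNReal.ofReal (1 - lam) * D Q1 P0 + ENNReal.ofReal lam * D Q2 P0)
    (ε0 ε α : ℝ) (hε0 : 0 ≤ ε0) (hε0ε : ε0 < ε) (hα : 0 < α) :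
    (OKL D P0 Pθ (ε + α) ≤ OKL D P0 Pθ ε ∧
      OKL D P0 Pθ ε ≤ OKL D P0 Pθ (ε + α) +
        ENNReal.ofReal (α / (ε - ε0 + α)) * OKL D P0 Pθ ε0) ∧
    (α ≤ ε - ε0 →
      OKL D P0 Pθ ε ≤ OKL D P0 Pθ (ε - α) ∧
      OKL D P0 Pθ (ε - α) ≤ OKL D P0 Pθ ε +
        ENNReal.ofReal (α / (ε - ε0)) * OKL D P0 Pθ ε0) := by
  have key : ∀ r : ℝ, ε0 < r → α ≤ r - ε0 → OKL D P0 Pθ (r - α) ≤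
      OKL D P0 Pθ r + ENNReal.ofReal (α / (r - ε0)) * OKL D P0 Pθ ε0 := by
    intro r hr hαr
    have hpos : 0 < r - ε0 := sub_pos.2 hr
    have h := OKL_le_add_mul P0 Pθ D hconv (hε0.trans hr.le) hε0 (div_pos hα hpos)
      ((div_le_one hpos).2 hαr)
    have he : (1 - α / (r - ε0)) * r + α / (r - ε0) * ε0 = r - α := by
      field_simp
      ring
    rwa [he] at h
  refine ⟨⟨OKL_antitone D P0 Pθ (by linarith), ?_⟩, fun hα' =>
    ⟨OKL_antitone D P0 Pθ (by linarith), key ε hε0ε hα'⟩⟩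
  have h := key (ε + α) (by linarith) (by linarith)
  rwa [add_sub_cancel_right, add_sub_right_comm] at h
end

section
/- Let (X, λ) be a σ-finite measure space and let p, q, r : X → [0,∞) be measurable probability densities with respect to λ (each integrating to 1) with q(x) > 0 for λ-almost every x. Let φ : ℝ → ℝ ∪ {∞} be a proper convex function with φ(1) = 0. If r is sandwiched between p and q, then ∫ φ(r(x)/q(x)) q(x) dλ(x) ≤ ∫ φ(p(x)/q(x)) q(x) dλ(x), where both integrals are well defined with values in (−∞, ∞] because φ is bounded below by an affine function vanishing at 1. -/
open MeasureTheory ENNReal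
open scoped Classical

/-- The nonnegative part of an extended real, as an extended nonnegative real. -/
noncomputable def erealPos (x : EReal) : ℝ≥0∞ :=
  if x = ⊤ then ⊤ else ENNReal.ofReal x.toReal

/-- The integral of an `EReal`-valued function, defined as the (extended-real) difference of
the lower integrals of its positive and negative parts. -/
noncomputable def integralEReal {X : Type*} [MeasurableSpace X] (μ : Measure X)
    (f : X → EReal) : EReal :=
  ((∫⁻ x, erealPos (f x) ∂μ : ℝ≥0∞) : EReal) - ((∫⁻ x, erealPos (-(f x)) ∂μ : ℝ≥0∞) : EReal)

theorem erealPos_coe (a : ℝ) : erealPos (a : EReal) = ENNReal.ofReal a := by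
  simp [erealPos]

theorem erealPos_top : erealPos ⊤ = ⊤ := by
  simp [erealPos]

theorem erealPos_bot : erealPos ⊥ = 0 := by
  simp [erealPos]

/-- The excess of `φ` over the affine function of slope `ξ` vanishing at `1`. -/
noncomputable def affineExcess (φ : ℝ → EReal) (ξ t : ℝ) : ℝ≥0∞ :=
  erealPos (φ t - ((ξ * (t - 1) : ℝ) : EReal))

theorem affineExcess_of_eq_coe {φ : ℝ → EReal} {ξ t a : ℝ} (h : φ t = a) :
    affineExcess φ ξ t = ENNReal.ofReal (a - ξ * (t - 1)) := by
  rw [affineExcess, h, ← EReal.coe_sub, erealPos_coe]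

theorem affineExcess_of_eq_top {φ : ℝ → EReal} {ξ t : ℝ} (h : φ t = ⊤) :
    affineExcess φ ξ t = ⊤ := by
  rw [affineExcess, h, EReal.top_sub_coe, erealPos_top]

theorem affineExcess_one {φ : ℝ → EReal} (hφ1 : φ 1 = 0) (ξ : ℝ) : affineExcess φ ξ 1 = 0 := by
  rw [affineExcess_of_eq_coe (a := 0) (by simpa using hφ1)]
  simp

/-- The excess of a convex function over a supporting line at `1` decreases towards `1`. -/
theorem affineExcess_le {φ : ℝ → EReal} {ξ : ℝ} (hφbot : ∀ x, φ x ≠ ⊥) (hφ1 : φ 1 = 0)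
    (hconv : ∀ x y t : ℝ, 0 ≤ t → t ≤ 1 →
      φ ((1 - t) * x + t * y) ≤ ((1 - t : ℝ) : EReal) * φ x + ((t : ℝ) : EReal) * φ y)
    (hsub : ∀ x : ℝ, ((ξ * (x - 1) : ℝ) : EReal) ≤ φ x) {s t : ℝ}
    (h : min t 1 ≤ s ∧ s ≤ max t 1) : affineExcess φ ξ s ≤ affineExcess φ ξ t := by
  by_cases ht : φ t = ⊤
  · simp [affineExcess_of_eq_top ht]
  obtain ⟨u, hu0, hu1, rfl⟩ : ∃ u : ℝ, 0 ≤ u ∧ u ≤ 1 ∧ s = (1 - u) * 1 + u * t := by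
    have hs : s ∈ segment ℝ 1 t := by
      rw [segment_eq_uIcc, Set.uIcc_comm]
      exact h
    obtain ⟨a, u, ha, hu, hau, rfl⟩ := hs
    exact ⟨u, hu, by linarith, by simp [← hau]⟩
  lift φ t to ℝ using ⟨ht, hφbot t⟩ with y hy
  have hle := hconv 1 t u hu0 hu1
  rw [hφ1, ← hy, mul_zero, zero_add, ← EReal.coe_mul] at hle
  have hst : φ ((1 - u) * 1 + u * t) ≠ ⊤ := ne_top_of_le_ne_top (EReal.coe_ne_top _) hle
  lift φ ((1 - u) * 1 + u * t) to ℝ using ⟨hst, hφbot _⟩ with z hz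
  have hty := hsub t
  rw [← hy, EReal.coe_le_coe_iff] at hty
  rw [EReal.coe_le_coe_iff] at hle
  rw [affineExcess_of_eq_coe hz.symm, affineExcess_of_eq_coe hy.symm]
  apply ENNReal.ofReal_le_ofReal
  nlinarith [mul_nonneg (sub_nonneg.2 hu1) (sub_nonneg.2 hty)]

theorem measurable_affineExcess {φ : ℝ → EReal} {ξ : ℝ} (hφbot : ∀ x, φ x ≠ ⊥) (hφ1 : φ 1 = 0)
    (hconv : ∀ x y t : ℝ, 0 ≤ t → t ≤ 1 →
      φ ((1 - t) * x + t * y) ≤ ((1 - t : ℝ) : EReal) * φ x + ((t : ℝ) : EReal) * φ y)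
    (hsub : ∀ x : ℝ, ((ξ * (x - 1) : ℝ) : EReal) ≤ φ x) : Measurable (affineExcess φ ξ) := by
  have hle {s t : ℝ} := affineExcess_le (s := s) (t := t) hφbot hφ1 hconv hsub
  have hanti : Antitone fun t => affineExcess φ ξ (min t 1) := fun s t hst =>
    hle ⟨(min_le_left _ _).trans (min_le_min_right 1 hst), by simp⟩
  have hmono : Monotone fun t => affineExcess φ ξ (max t 1) := fun s t hst =>
    hle ⟨by simp, (max_le_max_right 1 hst).trans (le_max_left _ _)⟩
  convert hanti.measurable.add hmono.measurable using 1
  ext t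
  rcases le_total t 1 with h | h <;> simp [h, affineExcess_one hφ1]

theorem ofReal_add_ofReal_neg_eq {a l : ℝ} (h : l ≤ a) :
    ENNReal.ofReal a + ENNReal.ofReal (-l) =
      ENNReal.ofReal (-a) + (ENNReal.ofReal (a - l) + ENNReal.ofReal l) := by
  rcases le_total 0 a with ha | ha <;> rcases le_total 0 l with hl | hl
  · rw [ENNReal.ofReal_of_nonpos (p := -l) (by linarith),
      ENNReal.ofReal_of_nonpos (p := -a) (by linarith), ← ENNReal.ofReal_add (by linarith) hl]
    simp
  · rw [ENNReal.ofReal_of_nonpos hl, ENNReal.ofReal_of_nonpos (p := -a) (by linarith),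
      ← ENNReal.ofReal_add ha (by linarith)]
    simp [sub_eq_add_neg]
  · obtain rfl : l = 0 := by linarith
    obtain rfl : a = 0 := by linarith
    simp
  · rw [ENNReal.ofReal_of_nonpos ha, ENNReal.ofReal_of_nonpos hl, add_zero, zero_add,
      ← ENNReal.ofReal_add (by linarith) (by linarith)]
    congr 1
    ring

theorem erealPos_mul_add_eq {φ : ℝ → EReal} {ξ : ℝ} (hφbot : ∀ x, φ x ≠ ⊥)
    (hsub : ∀ x : ℝ, ((ξ * (x - 1) : ℝ) : EReal) ≤ φ x) {a b : ℝ} (hb : 0 < b) :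
    erealPos (φ (a / b) * (b : EReal)) + ENNReal.ofReal (-(ξ * (a - b))) =
      erealPos (-(φ (a / b) * (b : EReal))) +
        (affineExcess φ ξ (a / b) * ENNReal.ofReal b + ENNReal.ofReal (ξ * (a - b))) := by
  by_cases ht : φ (a / b) = ⊤
  · rw [affineExcess_of_eq_top ht, ht, EReal.top_mul_coe_of_pos hb,
      ENNReal.top_mul (by simpa using hb), erealPos_top]
    simp
  have hle := hsub (a / b)
  lift φ (a / b) to ℝ using ⟨ht, hφbot _⟩ with y hy
  rw [EReal.coe_le_coe_iff] at hle
  have hl : ξ * (a - b) = ξ * (a / b - 1) * b := by field_simp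
  rw [affineExcess_of_eq_coe hy.symm, ← EReal.coe_mul, ← EReal.coe_neg, erealPos_coe,
    erealPos_coe, ← ENNReal.ofReal_mul (by linarith), sub_mul, ← hl]
  apply ofReal_add_ofReal_neg_eq
  rw [hl]
  exact mul_le_mul_of_nonneg_right hle hb.le

theorem erealPos_neg_mul_le {φ : ℝ → EReal} {ξ : ℝ} (hφbot : ∀ x, φ x ≠ ⊥)
    (hsub : ∀ x : ℝ, ((ξ * (x - 1) : ℝ) : EReal) ≤ φ x) {a b : ℝ} (hb : 0 < b) :
    erealPos (-(φ (a / b) * (b : EReal))) ≤ ENNReal.ofReal (-(ξ * (a - b))) := by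
  by_cases ht : φ (a / b) = ⊤
  · simp [ht, EReal.top_mul_coe_of_pos hb, erealPos_bot]
  have hle := hsub (a / b)
  lift φ (a / b) to ℝ using ⟨ht, hφbot _⟩ with y hy
  rw [EReal.coe_le_coe_iff] at hle
  have hl : ξ * (a - b) = ξ * (a / b - 1) * b := by field_simp
  rw [← EReal.coe_mul, ← EReal.coe_neg, erealPos_coe, hl]
  exact ENNReal.ofReal_le_ofReal (neg_le_neg (mul_le_mul_of_nonneg_right hle hb.le))

theorem integrable_and_integral_eq_one {X : Type*} [MeasurableSpace X] {lam : Measure X}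
    {p : X → ℝ} (hpm : Measurable p) (hp0 : ∀ x, 0 ≤ p x)
    (hp1 : ∫⁻ x, ENNReal.ofReal (p x) ∂lam = 1) : Integrable p lam ∧ ∫ x, p x ∂lam = 1 := by
  refine ⟨(lintegral_ofReal_ne_top_iff_integrable hpm.aestronglyMeasurable
    (Filter.Eventually.of_forall hp0)).1 (by simp [hp1]), ?_⟩
  rw [integral_eq_lintegral_of_nonneg_ae (Filter.Eventually.of_forall hp0)
    hpm.aestronglyMeasurable, hp1, ENNReal.toReal_one]

/-- The `φ`-divergence is the integral of the nonnegative excess of `φ` over a supporting line. -/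
theorem integralEReal_eq_lintegral_affineExcess {X : Type*} [MeasurableSpace X] {lam : Measure X}
    {p q : X → ℝ} (hpm : Measurable p) (hqm : Measurable q)
    (hp0 : ∀ x, 0 ≤ p x) (hq0 : ∀ x, 0 ≤ q x)
    (hp1 : ∫⁻ x, ENNReal.ofReal (p x) ∂lam = 1) (hq1 : ∫⁻ x, ENNReal.ofReal (q x) ∂lam = 1)
    (hqpos : ∀ᵐ x ∂lam, 0 < q x) {φ : ℝ → EReal} {ξ : ℝ} (hφbot : ∀ x, φ x ≠ ⊥)
    (hsub : ∀ x : ℝ, ((ξ * (x - 1) : ℝ) : EReal) ≤ φ x) (hm : Measurable (affineExcess φ ξ)) :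
    integralEReal lam (fun x => φ (p x / q x) * ((q x : ℝ) : EReal)) =
      ((∫⁻ x, affineExcess φ ξ (p x / q x) * ENNReal.ofReal (q x) ∂lam : ℝ≥0∞) : EReal) := by
  obtain ⟨hpi, hpI⟩ := integrable_and_integral_eq_one hpm hp0 hp1
  obtain ⟨hqi, hqI⟩ := integrable_and_integral_eq_one hqm hq0 hq1
  have hli : Integrable (fun x => ξ * (p x - q x)) lam := (hpi.sub hqi).const_mul ξ
  have hlI : ∫ x, ξ * (p x - q x) ∂lam = 0 := by
    rw [integral_const_mul, integral_sub hpi hqi, hpI, hqI, sub_self, mul_zero]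
  have hpos : ∫⁻ x, ENNReal.ofReal (ξ * (p x - q x)) ∂lam ≠ ⊤ := hli.lintegral_lt_top.ne
  have hneg : ∫⁻ x, ENNReal.ofReal (-(ξ * (p x - q x))) ∂lam ≠ ⊤ := hli.neg.lintegral_lt_top.ne
  have hbal : ∫⁻ x, ENNReal.ofReal (-(ξ * (p x - q x))) ∂lam =
      ∫⁻ x, ENNReal.ofReal (ξ * (p x - q x)) ∂lam := by
    rw [integral_eq_lintegral_pos_part_sub_lintegral_neg_part hli, sub_eq_zero] at hlI
    exact ((ENNReal.toReal_eq_toReal_iff' hpos hneg).1 hlI).symm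
  have hsum := lintegral_congr_ae (μ := lam)
    (hqpos.mono fun x hx => erealPos_mul_add_eq hφbot hsub (a := p x) hx)
  rw [lintegral_add_right _ (by fun_prop), lintegral_add_right _ (by fun_prop),
    lintegral_add_right _ (by fun_prop), hbal, ← add_assoc,
    ENNReal.add_left_inj hpos] at hsum
  have hfin : ∫⁻ x, erealPos (-(φ (p x / q x) * ((q x : ℝ) : EReal))) ∂lam ≠ ⊤ :=
    ne_top_of_le_ne_top hneg
      (lintegral_mono_ae (hqpos.mono fun x hx => erealPos_neg_mul_le hφbot hsub hx))
  rw [integralEReal, hsum, EReal.coe_ennreal_add, ← ENNReal.ofReal_toReal hfin,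
    EReal.coe_ennreal_ofReal, add_comm, EReal.add_sub_cancel_right]

/-- If a probability density `r` is sandwiched between probability densities `p` and `q`
(with `q > 0` a.e.), then `D_φ(r, q) ≤ D_φ(p, q)` for any proper convex `φ : ℝ → ℝ ∪ {∞}`
with `φ(1) = 0`; both φ-divergence integrals are well defined with values in `(−∞, ∞]`
because `φ` is bounded below by an affine function vanishing at `1`. -/
theorem stmt1 {X : Type*} [MeasurableSpace X] (lam : Measure X) [SigmaFinite lam]
    (p q r : X → ℝ) (hpm : Measurable p) (hqm : Measurable q) (hrm : Measurable r)
    (hp0 : ∀ x, 0 ≤ p x) (hq0 : ∀ x, 0 ≤ q x) (hr0 : ∀ x, 0 ≤ r x)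
    (hp1 : ∫⁻ x, ENNReal.ofReal (p x) ∂lam = 1)
    (hq1 : ∫⁻ x, ENNReal.ofReal (q x) ∂lam = 1)
    (hr1 : ∫⁻ x, ENNReal.ofReal (r x) ∂lam = 1)
    (hqpos : ∀ᵐ x ∂lam, 0 < q x)
    (φ : ℝ → EReal) (hφbot : ∀ x, φ x ≠ ⊥) (hφ1 : φ 1 = 0)
    (hconv : ∀ x y t : ℝ, 0 ≤ t → t ≤ 1 →
      φ ((1 - t) * x + t * y) ≤ ((1 - t : ℝ) : EReal) * φ x + ((t : ℝ) : EReal) * φ y)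
    (hsub : ∃ ξ : ℝ, ∀ x : ℝ, ((ξ * (x - 1) : ℝ) : EReal) ≤ φ x)
    (hsand : ∀ᵐ x ∂lam, min (p x) (q x) ≤ r x ∧ r x ≤ max (p x) (q x)) :
    integralEReal lam (fun x => φ (r x / q x) * ((q x : ℝ) : EReal)) ≤
      integralEReal lam (fun x => φ (p x / q x) * ((q x : ℝ) : EReal)) := by
  obtain ⟨ξ, hξ⟩ := hsub
  have hm := measurable_affineExcess hφbot hφ1 hconv hξ
  rw [integralEReal_eq_lintegral_affineExcess hrm hqm hr0 hq0 hr1 hq1 hqpos hφbot hξ hm,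
    integralEReal_eq_lintegral_affineExcess hpm hqm hp0 hq0 hp1 hq1 hqpos hφbot hξ hm,
    EReal.coe_ennreal_le_coe_ennreal_iff]
  refine lintegral_mono_ae ?_
  filter_upwards [hqpos, hsand] with x hq ⟨h1, h2⟩
  gcongr
  refine affineExcess_le hφbot hφ1 hconv hξ ⟨?_, ?_⟩
  · rw [← div_self hq.ne', min_div_div_right hq.le]
    exact div_le_div_of_nonneg_right h1 hq.le
  · rw [← div_self hq.ne', max_div_div_right hq.le]
    exact div_le_div_of_nonneg_right h2 hq.le
end

section
/- Let (X, λ) be a σ-finite measure space and let p, q, r : X → [0,∞) be measurable probability densities with respect to λ (each integrating to 1). If, up to λ-null sets, {x : r(x) < q(x)} ⊆ {x : p(x) ≤ r(x)}, or, up to λ-null sets, {x : r(x) > q(x)} ⊆ {x : p(x) ≥ r(x)}, then tv(p, r) ≤ tv(p, q). -/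
open MeasureTheory ENNReal

/-- Total variation distance between densities: `tv(p, q) = (1/2) ∫ |p − q| dλ`. -/
noncomputable def tvDist {X : Type*} [MeasurableSpace X] (lam : Measure X)
    (p q : X → ℝ) : ℝ≥0∞ :=
  (∫⁻ x, ENNReal.ofReal |p x - q x| ∂lam) / 2

/-- If `f + a ≤ g + b` almost everywhere, where the nonnegative parts of `a` and `b` have the same
finite integral, then the integral of `f` is at most that of `g`. -/
theorem lintegral_ofReal_le_of_add_le_add {X : Type*} [MeasurableSpace X] {lam : Measure X}
    {f g a b : X → ℝ} (ha : Measurable a) (hb : Measurable b)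
    (hf0 : ∀ x, 0 ≤ f x) (hg0 : ∀ x, 0 ≤ g x) (ha0 : ∀ x, 0 ≤ a x) (hb0 : ∀ x, 0 ≤ b x)
    (hab : ∫⁻ x, ENNReal.ofReal (a x) ∂lam = ∫⁻ x, ENNReal.ofReal (b x) ∂lam)
    (hfin : ∫⁻ x, ENNReal.ofReal (b x) ∂lam ≠ ∞)
    (h : ∀ᵐ x ∂lam, f x + a x ≤ g x + b x) :
    ∫⁻ x, ENNReal.ofReal (f x) ∂lam ≤ ∫⁻ x, ENNReal.ofReal (g x) ∂lam := by
  refine (ENNReal.add_le_add_iff_right hfin).1 ?_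
  nth_rewrite 1 [← hab]
  rw [← lintegral_add_right _ ha.ennreal_ofReal, ← lintegral_add_right _ hb.ennreal_ofReal]
  refine lintegral_mono_ae ?_
  filter_upwards [h] with x hx
  rw [← ENNReal.ofReal_add (hf0 x) (ha0 x), ← ENNReal.ofReal_add (hg0 x) (hb0 x)]
  exact ENNReal.ofReal_le_ofReal hx

/-- If, up to `λ`-null sets, `{r < q} ⊆ {p ≤ r}` or `{r > q} ⊆ {p ≥ r}`, then
`tv(p, r) ≤ tv(p, q)` for probability densities `p, q, r`. -/
theorem stmt2 {X : Type*} [MeasurableSpace X] (lam : Measure X) [SigmaFinite lam]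
    (p q r : X → ℝ) (hpm : Measurable p) (hqm : Measurable q) (hrm : Measurable r)
    (hp0 : ∀ x, 0 ≤ p x) (hq0 : ∀ x, 0 ≤ q x) (hr0 : ∀ x, 0 ≤ r x)
    (hp1 : ∫⁻ x, ENNReal.ofReal (p x) ∂lam = 1)
    (hq1 : ∫⁻ x, ENNReal.ofReal (q x) ∂lam = 1)
    (hr1 : ∫⁻ x, ENNReal.ofReal (r x) ∂lam = 1)
    (hcond : (∀ᵐ x ∂lam, r x < q x → p x ≤ r x) ∨
             (∀ᵐ x ∂lam, q x < r x → r x ≤ p x)) :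
    tvDist lam p r ≤ tvDist lam p q := by
  unfold tvDist
  refine ENNReal.div_le_div_right ?_ 2
  rcases hcond with h | h
  · refine lintegral_ofReal_le_of_add_le_add hqm hrm (fun _ => abs_nonneg _)
      (fun _ => abs_nonneg _) hq0 hr0 (hq1.trans hr1.symm) (by simp [hr1]) ?_
    filter_upwards [h] with x hx
    grind
  · refine lintegral_ofReal_le_of_add_le_add hrm hqm (fun _ => abs_nonneg _)
      (fun _ => abs_nonneg _) hr0 hq0 (hr1.trans hq1.symm) (by simp [hq1]) ?_
    filter_upwards [h] with x hx
    grind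
end

section
/- Let (X, λ) be a σ-finite measure space and let p0 and pθ be probability densities with respect to λ. For every probability density q with respect to λ there exists a probability density q̄ with respect to λ that is sandwiched between p0 and pθ and satisfies tv(q̄, p0) ≤ tv(q, p0) and KL(q̄ | pθ) ≤ KL(q | pθ). Consequently, if there exists a density q* minimizing KL(· | pθ) over the set {q : tv(q, p0) ≤ ε} and this minimizer is λ-a.e. unique, then q* is sandwiched between p0 and pθ. -/
open MeasureTheory ENNReal
open scoped Classical

/-- `f` is a probability density with respect to `lam`. -/
def IsDensity {X : Type*} [MeasurableSpace X] (lam : Measure X) (f : X → ℝ) : Prop :=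
  Measurable f ∧ (∀ x, 0 ≤ f x) ∧ ∫⁻ x, ENNReal.ofReal (f x) ∂lam = 1

/-- Kullback–Leibler divergence between densities, `KL(p|q) = ∫ p log(p/q) dλ` if `p` is
absolutely continuous with respect to `q` (with convention `0 log 0 = 0`), `∞` otherwise;
non-integrability of the integrand corresponds to the value `∞`. -/
noncomputable def KLd {X : Type*} [MeasurableSpace X] (lam : Measure X)
    (p q : X → ℝ) : ℝ≥0∞ :=
  if (∀ᵐ x ∂lam, q x = 0 → p x = 0) ∧
      Integrable (fun x => p x * Real.log (p x / q x)) lam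
  then ENNReal.ofReal (∫ x, p x * Real.log (p x / q x) ∂lam) else ⊤

/-- The pointwise Bregman form of the Kullback–Leibler integrand, with derivative
`log (a / p)` in `a`. -/
noncomputable def klIntegrand (a p : ℝ) : ℝ := a * Real.log (a / p) - a + p

lemma sub_le_mul_log_div {a b : ℝ} (ha : 0 ≤ a) (hb : 0 < b) :
    a - b ≤ a * Real.log (a / b) := by
  rcases ha.eq_or_lt with rfl | ha
  · simpa using hb.le
  · have h := Real.one_sub_inv_le_log_of_pos (div_pos ha hb)
    have h' := mul_le_mul_of_nonneg_left h ha.le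
    have : a * (1 - (a / b)⁻¹) = a - b := by field_simp
    linarith

lemma klIntegrand_nonneg {a p : ℝ} (ha : 0 ≤ a) (hp : 0 ≤ p) (hap : p = 0 → a = 0) :
    0 ≤ klIntegrand a p := by
  rcases hp.eq_or_lt with rfl | hp
  · simp [klIntegrand, hap rfl]
  · have := sub_le_mul_log_div ha hp
    unfold klIntegrand
    linarith

lemma klIntegrand_le_of_mem_uIcc {a b p : ℝ} (ha : 0 ≤ a) (hp : 0 ≤ p) (hap : p = 0 → a = 0)
    (hb : b ∈ Set.uIcc a p) : klIntegrand b p ≤ klIntegrand a p := by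
  rcases hp.eq_or_lt with rfl | hp
  · obtain rfl := hap rfl
    simp_all
  have hb0 : 0 ≤ b := (le_min ha hp.le).trans hb.1
  rcases hb0.eq_or_lt with rfl | hb0
  · rcases Set.mem_uIcc.1 hb with h | h
    · rw [le_antisymm h.1 ha]
    · linarith
  rcases ha.eq_or_lt with rfl | ha
  · rcases Set.mem_uIcc.1 hb with h | h
    · have h1 : Real.log (b / p) ≤ 0 :=
        Real.log_nonpos (by positivity) ((div_le_one hp).2 h.2)
      have := mul_nonpos_of_nonneg_of_nonpos hb0.le h1
      simp only [klIntegrand, zero_mul]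
      linarith
    · linarith
  have h1 := sub_le_mul_log_div ha.le hb0
  have h2 : 0 ≤ (a - b) * Real.log (b / p) := by
    rcases Set.mem_uIcc.1 hb with h | h
    · exact mul_nonneg_of_nonpos_of_nonpos (by linarith)
        (Real.log_nonpos (by positivity) ((div_le_one hp).2 h.2))
    · exact mul_nonneg (by linarith) (Real.log_nonneg ((one_le_div hp).2 h.1))
  rw [Real.log_div ha.ne' hb0.ne'] at h1
  rw [Real.log_div hb0.ne' hp.ne'] at h2
  simp only [klIntegrand, Real.log_div ha.ne' hp.ne', Real.log_div hb0.ne' hp.ne']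
  linarith

section Density

variable {X : Type*} [MeasurableSpace X] {lam : Measure X}

lemma IsDensity.integrable {f : X → ℝ} (hf : IsDensity lam f) : Integrable f lam := by
  refine ⟨hf.1.aestronglyMeasurable, ?_⟩
  rw [hasFiniteIntegral_iff_ofReal (.of_forall hf.2.1), hf.2.2]
  exact one_lt_top

lemma IsDensity.integral_eq_one {f : X → ℝ} (hf : IsDensity lam f) : ∫ x, f x ∂lam = 1 := by
  rw [integral_eq_lintegral_of_nonneg_ae (.of_forall hf.2.1) hf.1.aestronglyMeasurable, hf.2.2]
  simp

lemma isDensity_of_integral_eq_one {f : X → ℝ} (hm : Measurable f) (h0 : ∀ x, 0 ≤ f x)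
    (hi : Integrable f lam) (h1 : ∫ x, f x ∂lam = 1) : IsDensity lam f :=
  ⟨hm, h0, by rw [← ofReal_integral_eq_lintegral_ofReal hi (.of_forall h0), h1, ofReal_one]⟩

lemma integrable_abs_sub {f g : X → ℝ} (hf : Integrable f lam) (hg : Integrable g lam) :
    Integrable (fun x => |f x - g x|) lam :=
  (hf.sub hg).abs

lemma tvDist_le_tvDist {p q r : X → ℝ} (hp : Integrable p lam) (hq : Integrable q lam)
    (hr : Integrable r lam) (h : ∫ x, |q x - p x| ∂lam ≤ ∫ x, |r x - p x| ∂lam) :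
    tvDist lam q p ≤ tvDist lam r p := by
  unfold tvDist
  rw [← ofReal_integral_eq_lintegral_ofReal (integrable_abs_sub hq hp) (.of_forall fun _ => abs_nonneg _),
    ← ofReal_integral_eq_lintegral_ofReal (integrable_abs_sub hr hp) (.of_forall fun _ => abs_nonneg _)]
  gcongr

/-- Moving a density pointwise towards `p` decreases its divergence from `p`. -/
lemma KLd_le_of_mem_uIcc {p q r : X → ℝ} (hp : IsDensity lam p) (hq : IsDensity lam q)
    (hr : IsDensity lam r) (h : ∀ x, r x ∈ Set.uIcc (q x) (p x)) :
    KLd lam r p ≤ KLd lam q p := by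
  by_cases hc : (∀ᵐ x ∂lam, p x = 0 → q x = 0) ∧
      Integrable (fun x => q x * Real.log (q x / p x)) lam
  swap
  · simp only [KLd, if_neg hc, le_top]
  obtain ⟨hac, hint⟩ := hc
  have hac' : ∀ᵐ x ∂lam, p x = 0 → r x = 0 := by
    filter_upwards [hac] with x hx hpx
    have := h x
    simpa [hx hpx, hpx] using this
  have hqi : Integrable (fun x => klIntegrand (q x) (p x)) lam :=
    (hint.sub hq.integrable).add hp.integrable
  have hle : ∀ᵐ x ∂lam, klIntegrand (r x) (p x) ≤ klIntegrand (q x) (p x) := by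
    filter_upwards [hac] with x hx
    exact klIntegrand_le_of_mem_uIcc (hq.2.1 x) (hp.2.1 x) hx (h x)
  have hri : Integrable (fun x => klIntegrand (r x) (p x)) lam := by
    refine hqi.mono' ?_ ?_
    · have := hr.1
      have := hp.1
      unfold klIntegrand
      exact Measurable.aestronglyMeasurable (by fun_prop)
    · filter_upwards [hac', hle] with x hx hx'
      rwa [Real.norm_of_nonneg (klIntegrand_nonneg (hr.2.1 x) (hp.2.1 x) hx)]
  have hint' : Integrable (fun x => r x * Real.log (r x / p x)) lam := by
    refine ((hri.add hr.integrable).sub hp.integrable).congr (.of_forall fun x => ?_)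
    simp only [klIntegrand, Pi.add_apply, Pi.sub_apply]
    ring
  have hintegral : ∀ f : X → ℝ, IsDensity lam f →
      Integrable (fun x => f x * Real.log (f x / p x)) lam →
      ∫ x, klIntegrand (f x) (p x) ∂lam = ∫ x, f x * Real.log (f x / p x) ∂lam := by
    intro f hf hfi
    have hsub : Integrable (fun x => f x * Real.log (f x / p x) - f x) lam :=
      hfi.sub hf.integrable
    simp only [klIntegrand]
    rw [integral_add hsub hp.integrable, integral_sub hfi hf.integrable,
      hf.integral_eq_one, hp.integral_eq_one]
    ring
  have hmono := integral_mono_ae hri hqi hle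
  rw [hintegral r hr hint', hintegral q hq hint] at hmono
  simp only [KLd]
  rw [if_pos ⟨hac', hint'⟩, if_pos ⟨hac, hint⟩]
  exact ofReal_le_ofReal hmono

/-- An integrable function can be moved pointwise towards a function of integral `1` so that its
integral becomes `1`, at an `L¹` cost equal to its defect of mass. -/
lemma exists_mem_uIcc_integral_eq_one {c p : X → ℝ} (hcm : Measurable c) (hpm : Measurable p)
    (hc : Integrable c lam) (hp : Integrable p lam) (hp1 : ∫ x, p x ∂lam = 1) :
    ∃ e : X → ℝ, Measurable e ∧ Integrable e lam ∧ (∀ x, e x ∈ Set.uIcc (c x) (p x)) ∧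
      ∫ x, e x ∂lam = 1 ∧ ∫ x, |e x - c x| ∂lam = |1 - ∫ x, c x ∂lam| := by
  have key : ∀ d : X → ℝ, Measurable d → Integrable d lam →
      (∀ x, d x ∈ Set.uIcc (c x) (p x)) → 1 ∈ Set.uIcc (∫ x, c x ∂lam) (∫ x, d x ∂lam) →
      ((∀ x, c x ≤ d x) ∨ ∀ x, d x ≤ c x) →
      ∃ e : X → ℝ, Measurable e ∧ Integrable e lam ∧ (∀ x, e x ∈ Set.uIcc (c x) (p x)) ∧
        ∫ x, e x ∂lam = 1 ∧ ∫ x, |e x - c x| ∂lam = |1 - ∫ x, c x ∂lam| := by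
    intro d hdm hd hdu h1 hcd
    rw [← segment_eq_uIcc] at h1
    obtain ⟨s, t, hs, ht, hst, h1⟩ := h1
    have hei : Integrable (fun x => s * c x + t * d x) lam :=
      (hc.const_mul s).add (hd.const_mul t)
    have he1 : ∫ x, (s * c x + t * d x) ∂lam = 1 := by
      rw [integral_add (hc.const_mul s) (hd.const_mul t), integral_const_mul, integral_const_mul]
      exact h1
    have hsub : ∀ x, s * c x + t * d x - c x = t * (d x - c x) := fun x => by
      linear_combination (c x) * hst
    refine ⟨fun x => s * c x + t * d x, by fun_prop, hei, fun x => ?_, he1, ?_⟩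
    · exact (convex_uIcc (c x) (p x)) Set.left_mem_uIcc (hdu x) hs ht hst
    · rw [← he1, ← integral_sub hei hc]
      simp only [hsub, abs_mul, integral_const_mul]
      congr 1
      rcases hcd with hcd | hcd
      · simp_rw [abs_of_nonneg (sub_nonneg.2 (hcd _))]
        rw [abs_of_nonneg (integral_nonneg fun x => sub_nonneg.2 (hcd x))]
      · simp_rw [abs_of_nonpos (sub_nonpos.2 (hcd _))]
        rw [integral_neg, abs_of_nonpos (integral_nonpos fun x => sub_nonpos.2 (hcd x))]
  rcases le_total (∫ x, c x ∂lam) 1 with h | h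
  · refine key (fun x => max (c x) (p x)) (hcm.max hpm) (hc.sup hp)
      (fun x => ⟨inf_le_left.trans le_sup_left, le_rfl⟩) ?_ (.inl fun x => le_max_left _ _)
    exact Set.mem_uIcc.2 (.inl ⟨h, hp1.symm.le.trans
      (integral_mono hp (hc.sup hp) fun x => le_max_right _ _)⟩)
  · refine key (fun x => min (c x) (p x)) (hcm.min hpm) (hc.inf hp)
      (fun x => ⟨le_rfl, inf_le_left.trans le_sup_left⟩) ?_ (.inr fun x => min_le_left _ _)
    exact Set.mem_uIcc.2 (.inr ⟨(integral_mono (hc.inf hp) hp fun x => min_le_right _ _).trans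
      hp1.le, h⟩)

lemma exists_sandwiched_density {p0 pθ q : X → ℝ} (h0 : IsDensity lam p0)
    (hθ : IsDensity lam pθ) (hq : IsDensity lam q) :
    ∃ r : X → ℝ, IsDensity lam r ∧
      (∀ x, min (p0 x) (pθ x) ≤ r x ∧ r x ≤ max (p0 x) (pθ x)) ∧
      tvDist lam r p0 ≤ tvDist lam q p0 ∧ KLd lam r pθ ≤ KLd lam q pθ := by
  have hi0 := h0.integrable
  have hiθ := hθ.integrable
  have hiq := hq.integrable
  set c : X → ℝ := fun x => max (min (p0 x) (pθ x)) (min (q x) (max (p0 x) (pθ x))) with hc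
  have hcm : Measurable c := (h0.1.min hθ.1).max (hq.1.min (h0.1.max hθ.1))
  have hci : Integrable c lam := (hi0.inf hiθ).sup (hiq.inf (hi0.sup hiθ))
  obtain ⟨r, hrm, hri, hrc, hr1, hrd⟩ :=
    exists_mem_uIcc_integral_eq_one hcm hθ.1 hci hiθ hθ.integral_eq_one
  have hcs : ∀ x, c x ∈ Set.uIcc (p0 x) (pθ x) := fun x =>
    ⟨le_max_left _ _, max_le (min_le_left _ _ |>.trans (le_max_left _ _)) (min_le_right _ _)⟩
  have hrs : ∀ x, r x ∈ Set.uIcc (p0 x) (pθ x) := fun x =>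
    Set.uIcc_subset_uIcc (hcs x) Set.right_mem_uIcc (hrc x)
  have hcq : ∀ x, c x ∈ Set.uIcc (q x) (pθ x) := fun x => by
    simp only [hc, Set.mem_uIcc]
    grind
  have hrq : ∀ x, r x ∈ Set.uIcc (q x) (pθ x) := fun x =>
    Set.uIcc_subset_uIcc (hcq x) Set.right_mem_uIcc (hrc x)
  have hr : IsDensity lam r := isDensity_of_integral_eq_one hrm
    (fun x => (le_min (h0.2.1 x) (hθ.2.1 x)).trans (hrs x).1) hri hr1
  refine ⟨r, hr, hrs, tvDist_le_tvDist hi0 hri hiq ?_, KLd_le_of_mem_uIcc hθ hq hr hrq⟩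
  have hsplit : ∀ x, |q x - p0 x| = |q x - c x| + |c x - p0 x| := fun x => by
    simp only [hc]
    grind
  calc ∫ x, |r x - p0 x| ∂lam
      ≤ ∫ x, (|r x - c x| + |c x - p0 x|) ∂lam :=
        integral_mono (integrable_abs_sub hri hi0) ((integrable_abs_sub hri hci).add (integrable_abs_sub hci hi0))
          fun x => abs_sub_le _ _ _
    _ = |∫ x, (q x - c x) ∂lam| + ∫ x, |c x - p0 x| ∂lam := by
        rw [integral_add (integrable_abs_sub hri hci) (integrable_abs_sub hci hi0), hrd, integral_sub hiq hci,
          hq.integral_eq_one]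
    _ ≤ ∫ x, |q x - c x| ∂lam + ∫ x, |c x - p0 x| ∂lam := by
        gcongr
        exact abs_integral_le_integral_abs
    _ = ∫ x, |q x - p0 x| ∂lam := by
        simp_rw [hsplit]
        rw [integral_add (integrable_abs_sub hiq hci) (integrable_abs_sub hci hi0)]

end Density

/-- For every density `q` there is a density `q̄` sandwiched between `p0` and `pθ` with
`tv(q̄, p0) ≤ tv(q, p0)` and `KL(q̄|pθ) ≤ KL(q|pθ)`.  Consequently, a λ-a.e.-unique
minimizer of `KL(·|pθ)` over the TV-ball of radius `ε` around `p0` is sandwiched between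
`p0` and `pθ`. -/
theorem stmt3 {X : Type*} [MeasurableSpace X] (lam : Measure X) [SigmaFinite lam]
    (p0 pθ : X → ℝ) (h0 : IsDensity lam p0) (hθ : IsDensity lam pθ) :
    (∀ q : X → ℝ, IsDensity lam q →
      ∃ qbar : X → ℝ, IsDensity lam qbar ∧
        (∀ᵐ x ∂lam, min (p0 x) (pθ x) ≤ qbar x ∧ qbar x ≤ max (p0 x) (pθ x)) ∧
        tvDist lam qbar p0 ≤ tvDist lam q p0 ∧ KLd lam qbar pθ ≤ KLd lam q pθ) ∧
    (∀ ε : ℝ, 0 ≤ ε → ∀ qstar : X → ℝ, IsDensity lam qstar →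
      tvDist lam qstar p0 ≤ ENNReal.ofReal ε →
      (∀ q : X → ℝ, IsDensity lam q → tvDist lam q p0 ≤ ENNReal.ofReal ε →
        KLd lam qstar pθ ≤ KLd lam q pθ) →
      (∀ q : X → ℝ, IsDensity lam q → tvDist lam q p0 ≤ ENNReal.ofReal ε →
        KLd lam q pθ = KLd lam qstar pθ → q =ᵐ[lam] qstar) →
      ∀ᵐ x ∂lam, min (p0 x) (pθ x) ≤ qstar x ∧ qstar x ≤ max (p0 x) (pθ x)) := by
  refine ⟨fun q hq => ?_, fun ε _ qstar hq htv hmin huniq => ?_⟩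
  · obtain ⟨r, hr, hrs, htv, hkl⟩ := exists_sandwiched_density h0 hθ hq
    exact ⟨r, hr, .of_forall hrs, htv, hkl⟩
  · obtain ⟨r, hr, hrs, hrtv, hkl⟩ := exists_sandwiched_density h0 hθ hq
    have hr_tv := hrtv.trans htv
    filter_upwards [huniq r hr hr_tv (hkl.antisymm (hmin r hr hr_tv))] with x hx
    exact hx ▸ hrs x
end

section
/- Let X be a finite type and p, pθ probability vectors on X with KL(p | pθ) = Σ_x p(x) log(p(x)/pθ(x)) < ∞. For any integer n > |X| there exists a probability vector q on X such that n·q(x) is a non-negative integer for all x ∈ X, ‖q − p‖₁ ≤ 2|X|/n, and KL(q | pθ) ≤ (1 + |X|²/n) · KL(p | pθ) + (|X|/n) · ( 2 log(n/2) + log|X| + |X|/e ). -/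
open scoped BigOperators

open Finset

lemma mul_log_div_ge_sub {p t : ℝ} (hp : 0 ≤ p) (ht : 0 ≤ t) (h : t = 0 → p = 0) :
    p - t ≤ p * Real.log (p / t) := by
  rcases hp.eq_or_lt with rfl | hp
  · simpa using ht
  · have ht : 0 < t := ht.lt_of_ne fun h' => hp.ne' (h h'.symm)
    have h1 := mul_le_mul_of_nonneg_left (Real.one_sub_inv_le_log_of_pos (div_pos hp ht)) hp.le
    have h2 : p * (1 - (p / t)⁻¹) = p - t := by field_simp
    linarith

lemma mul_log_div_ge_neg_div_exp {p t : ℝ} (hp : 0 ≤ p) (ht : 0 ≤ t) (h : t = 0 → p = 0) :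
    -(t / Real.exp 1) ≤ p * Real.log (p / t) := by
  have he := Real.exp_pos 1
  rcases hp.eq_or_lt with rfl | hp
  · simpa using by positivity
  · have ht : 0 < t := ht.lt_of_ne fun h' => hp.ne' (h h'.symm)
    have h1 := mul_log_div_ge_sub hp.le (div_pos ht he).le
      fun h' => absurd h' (div_pos ht he).ne'
    have h2 : Real.log (p / (t / Real.exp 1)) = Real.log (p / t) + 1 := by
      rw [div_div_eq_mul_div, mul_div_right_comm,
        Real.log_mul (div_pos hp ht).ne' he.ne', Real.log_exp]
    rw [h2] at h1
    linarith

lemma mul_log_div_sub_le_of_le {p q t : ℝ} {n : ℕ} (hq : 0 ≤ q) (hqp : q ≤ p)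
    (ht : 0 ≤ t) (ht1 : t ≤ 1) (h : t = 0 → p = 0) (hn : 0 < n) :
    q * Real.log (q / t) - p * Real.log (p / t) ≤
      (p - q) * Real.log n + 1 / n - (p - q) := by
  have hn' : (0 : ℝ) < n := by exact_mod_cast hn
  rcases (hq.trans hqp).eq_or_lt with rfl | hp
  · obtain rfl : q = 0 := le_antisymm hqp hq
    simp
  have ht : 0 < t := ht.lt_of_ne fun h' => hp.ne' (h h'.symm)
  have h1 : q * Real.log (q / t) ≤ q * Real.log (p / t) := by
    rcases hq.eq_or_lt with rfl | hq
    · simp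
    · gcongr
  have h2 : Real.log p ≤ Real.log (p / t) :=
    Real.log_le_log hp (le_div_self hp.le ht ht1)
  have h3 : (p - q) * Real.log (p - q) ≤ (p - q) * Real.log p := by
    rcases (sub_nonneg.2 hqp).eq_or_lt with h0 | h0
    · simp [← h0]
    · gcongr; linarith
  have h4 := mul_log_div_ge_sub (t := 1 / (n : ℝ)) (sub_nonneg.2 hqp) (by positivity)
    fun h' => absurd h' (by positivity)
  have h5 : (p - q) * Real.log ((p - q) / (1 / n)) =
      (p - q) * Real.log (p - q) + (p - q) * Real.log n := by
    rcases (sub_nonneg.2 hqp).eq_or_lt with h0 | h0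
    · simp [← h0]
    · rw [div_div_eq_mul_div, div_one, Real.log_mul h0.ne' hn'.ne']; ring
  nlinarith [mul_le_mul_of_nonneg_left h2 (sub_nonneg.2 hqp)]

lemma mul_log_div_sub_le_of_ge {p q t : ℝ} (hp : 0 < p) (hpq : p ≤ q) (hq1 : q ≤ 1)
    (ht : 0 < t) :
    q * Real.log (q / t) - p * Real.log (p / t) ≤
      (q - p) * Real.log (p / t) - (q - p) * Real.log p + (q - p) := by
  have hq := hp.trans_le hpq
  rw [Real.log_div hq.ne' ht.ne', Real.log_div hp.ne' ht.ne']
  have h1 := mul_log_div_ge_sub hp.le hq.le fun h => absurd h hq.ne'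
  rw [Real.log_div hp.ne' hq.ne'] at h1
  have h2 := mul_nonpos_of_nonneg_of_nonpos (sub_nonneg.2 hpq) (Real.log_nonpos hq.le hq1)
  linarith

lemma card_log_bound {k n : ℝ} (hk : 1 ≤ k) (hn : k + 1 ≤ n) :
    (k - 1) * (Real.log n + 1) ≤
      2 * k * Real.log (n / 2) + Real.log k + k / Real.exp 1 := by
  have hn0 : 0 < n := by linarith
  rw [Real.log_div hn0.ne' two_ne_zero]
  have hl2 := Real.log_two_lt_d9
  have hl2' := Real.log_two_gt_d9
  have he : (0.3678 : ℝ) ≤ 1 / Real.exp 1 := by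
    rw [le_div_iff₀ (Real.exp_pos 1)]
    linarith [Real.exp_one_lt_d9]
  have hl3 : 3 * Real.log 2 ≤ 2 * Real.log 3 := by
    have h : Real.log ((2 : ℝ) ^ 3) ≤ Real.log ((3 : ℝ) ^ 2) :=
      Real.log_le_log (by norm_num) (by norm_num)
    rw [Real.log_pow, Real.log_pow] at h
    exact_mod_cast h
  have h1 : Real.log (k + 1) ≤ Real.log n := Real.log_le_log (by linarith) hn
  have h2 := mul_log_div_ge_sub (p := k + 1) (t := 3) (by linarith) (by norm_num) (by norm_num)
  rw [Real.log_div (by linarith) (by norm_num)] at h2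
  have h3 := Real.log_nonneg hk
  have h4 : k / Real.exp 1 = k * (1 / Real.exp 1) := by ring
  rw [h4]
  nlinarith [mul_le_mul_of_nonneg_left h1 (by linarith : (0 : ℝ) ≤ k + 1),
    mul_le_mul_of_nonneg_left he (by linarith : (0 : ℝ) ≤ k),
    mul_le_mul_of_nonneg_left hl3 (by linarith : (0 : ℝ) ≤ k + 1),
    mul_le_mul_of_nonneg_left hl2.le (by linarith : (0 : ℝ) ≤ k),
    mul_le_mul_of_nonneg_left hl2'.le (by linarith : (0 : ℝ) ≤ k)]

/-- Rounding lemma: any probability vector `p` with `KL(p|pθ) < ∞` can be approximated by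
a probability vector `q` with `n·q(x)` integral, `‖q − p‖₁ ≤ 2|X|/n`, and
`KL(q|pθ) ≤ (1 + |X|²/n) KL(p|pθ) + (|X|/n)(2 log(n/2) + log|X| + |X|/e)`. -/
theorem stmt7 {X : Type*} [Fintype X] (p pθ : X → ℝ)
    (hp0 : ∀ x, 0 ≤ p x) (hp1 : (∑ x, p x) = 1)
    (hpθ0 : ∀ x, 0 ≤ pθ x) (hpθ1 : (∑ x, pθ x) = 1)
    (habs : ∀ x, pθ x = 0 → p x = 0)
    (n : ℕ) (hn : Fintype.card X < n) :
    ∃ q : X → ℝ, (∀ x, 0 ≤ q x) ∧ (∑ x, q x) = 1 ∧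
      (∀ x, ∃ m : ℕ, q x = (m : ℝ) / n) ∧
      (∀ x, pθ x = 0 → q x = 0) ∧
      (∑ x, |q x - p x|) ≤ 2 * Fintype.card X / n ∧
      (∑ x, q x * Real.log (q x / pθ x)) ≤
        (1 + (Fintype.card X : ℝ) ^ 2 / n) * (∑ x, p x * Real.log (p x / pθ x)) +
          ((Fintype.card X : ℝ) / n) *
            (2 * Real.log ((n : ℝ) / 2) + Real.log (Fintype.card X) +
              (Fintype.card X : ℝ) / Real.exp 1) := by
  classical
  have hX : Nonempty X := by
    by_contra h
    rw [not_nonempty_iff] at h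
    simp at hp1
  have hn0 : 0 < n := by omega
  have hnR : (0 : ℝ) < n := by exact_mod_cast hn0
  have hθle : ∀ x, pθ x ≤ 1 := fun x =>
    hpθ1 ▸ single_le_sum (fun y _ => hpθ0 y) (mem_univ x)
  obtain ⟨a, ha⟩ := Finite.exists_max p
  set k : ℝ := (Fintype.card X : ℝ) with hkdef
  have hk : 1 ≤ k := by
    rw [hkdef]
    exact_mod_cast Fintype.card_pos (α := X)
  have hkn : k + 1 ≤ n := by
    rw [hkdef]
    exact_mod_cast hn
  have hpa : 1 ≤ k * p a := by
    have h := sum_le_card_nsmul univ p (p a) fun x _ => ha x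
    simpa [hp1] using h
  have hpa0 : 0 < p a := by
    by_contra h
    nlinarith
  have hta0 : 0 < pθ a := (hpθ0 a).lt_of_ne fun h => hpa0.ne' (habs a h.symm)
  have split : ∀ f : X → ℝ, ∑ x, f x = f a + ∑ x ∈ univ.erase a, f x := fun f =>
    (add_sum_erase _ f (mem_univ a)).symm
  have hcard : ((univ.erase a).card : ℝ) = k - 1 := by
    rw [card_erase_of_mem (mem_univ a), card_univ, Nat.cast_pred Fintype.card_pos]
  let r : X → ℕ := fun x => ⌊n * p x⌋₊
  have hr : ∀ x, (r x : ℝ) / n ≤ p x := fun x => by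
    rw [div_le_iff₀ hnR, mul_comm]
    exact Nat.floor_le (mul_nonneg hnR.le (hp0 x))
  have hr' : ∀ x, p x - r x / n ≤ 1 / n := fun x => by
    rw [sub_le_iff_le_add, ← add_div, le_div_iff₀ hnR]
    linarith [(Nat.lt_floor_add_one (n * p x)).le]
  set δ : ℝ := ∑ x ∈ univ.erase a, (p x - r x / n) with hδ
  have hδ0 : 0 ≤ δ := sum_nonneg fun x _ => sub_nonneg.2 (hr x)
  have hδ1 : δ ≤ (k - 1) / n := by
    have h := sum_le_card_nsmul (univ.erase a) _ _ fun x _ => hr' x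
    rw [nsmul_eq_mul, hcard] at h
    calc δ ≤ _ := h
      _ = _ := by ring
  have hδp : δ = 1 - p a - ∑ x ∈ univ.erase a, (r x : ℝ) / n := by
    rw [hδ, sum_sub_distrib, ← hp1, split p]
    ring
  have hs0 : 0 ≤ ∑ x ∈ univ.erase a, (r x : ℝ) / n := sum_nonneg fun x _ => by positivity
  let q : X → ℝ := fun x => if x = a then p a + δ else r x / n
  have hqa : q a = p a + δ := if_pos rfl
  have hqx : ∀ x ∈ univ.erase a, q x = r x / n := fun x hx => if_neg (ne_of_mem_erase hx)
  have hsumr : ∑ x ∈ univ.erase a, (r x : ℝ) / n =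
      ((∑ x ∈ univ.erase a, r x : ℕ) : ℝ) / n := by
    rw [← sum_div]
    push_cast
    rfl
  refine ⟨q, fun x => ?_, ?_, fun x => ?_, fun x hx => ?_, ?_, ?_⟩
  · by_cases hx : x = a
    · rw [hx, hqa]
      positivity
    · rw [hqx x (by simp [hx])]
      positivity
  · rw [split, sum_congr rfl hqx, hqa, hδp]
    ring
  · by_cases hx : x = a
    · have hle : ∑ x ∈ univ.erase a, r x ≤ n := by
        have h : ((∑ x ∈ univ.erase a, r x : ℕ) : ℝ) / n ≤ 1 := by
          rw [← hsumr]
          linarith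
        rw [div_le_one hnR] at h
        exact_mod_cast h
      refine ⟨n - ∑ x ∈ univ.erase a, r x, ?_⟩
      rw [hx, hqa, hδp, hsumr, Nat.cast_sub hle, sub_div, div_self hnR.ne']
      ring
    · exact ⟨r x, hqx x (by simp [hx])⟩
  · have hxa : x ≠ a := by
      rintro rfl
      exact hta0.ne' hx
    rw [hqx x (by simp [hxa])]
    simp [r, habs x hx]
  · have h : ∑ x ∈ univ.erase a, |q x - p x| = δ := sum_congr rfl fun x hx => by
      rw [hqx x hx, abs_sub_comm, abs_of_nonneg (sub_nonneg.2 (hr x))]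
    rw [split, h, hqa, add_sub_cancel_left, abs_of_nonneg hδ0]
    calc δ + δ ≤ (k - 1) / n + (k - 1) / n := add_le_add hδ1 hδ1
      _ = 2 * (k - 1) / n := by ring
      _ ≤ 2 * k / n := by gcongr; linarith
  · have hD0 : 0 ≤ ∑ x, p x * Real.log (p x / pθ x) := by
      have h := sum_le_sum fun x (_ : x ∈ univ) =>
        mul_log_div_ge_sub (hp0 x) (hpθ0 x) (habs x)
      rw [sum_sub_distrib, hp1, hpθ1, sub_self] at h
      exact h
    have hq1 : p a + δ ≤ 1 := by linarith
    have hmain := mul_log_div_sub_le_of_ge hpa0 (by linarith : p a ≤ p a + δ) hq1 hta0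
    have hrest : ∑ x ∈ univ.erase a,
        (q x * Real.log (q x / pθ x) - p x * Real.log (p x / pθ x)) ≤
        δ * Real.log n + (k - 1) / n - δ := by
      calc _ ≤ ∑ x ∈ univ.erase a,
            ((p x - r x / n) * Real.log n + 1 / n - (p x - r x / n)) :=
            sum_le_sum fun x hx => by
              rw [hqx x hx]
              exact mul_log_div_sub_le_of_le (by positivity) (hr x) (hpθ0 x) (hθle x)
                (habs x) hn0
        _ = _ := by
            rw [sum_sub_distrib, sum_add_distrib, ← sum_mul, sum_const, nsmul_eq_mul, hcard]
            ring
    rw [sum_sub_distrib] at hrest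
    have hlow : -(1 / Real.exp 1) ≤ ∑ x ∈ univ.erase a, p x * Real.log (p x / pθ x) := by
      calc -(1 / Real.exp 1) ≤ -((∑ x ∈ univ.erase a, pθ x) / Real.exp 1) := by
            gcongr
            linarith [split pθ]
        _ = ∑ x ∈ univ.erase a, -(pθ x / Real.exp 1) := by rw [sum_neg_distrib, sum_div]
        _ ≤ _ := sum_le_sum fun x _ =>
            mul_log_div_ge_neg_div_exp (hp0 x) (hpθ0 x) (habs x)
    have hsp := split fun x => p x * Real.log (p x / pθ x)
    have hsq := split fun x => q x * Real.log (q x / pθ x)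
    simp only [hqa] at hsq
    set D := ∑ x, p x * Real.log (p x / pθ x)
    have he : 0 < 1 / Real.exp 1 := by positivity
    have hratio : Real.log (p a / pθ a) ≤ k * (D + 1 / Real.exp 1) := by
      have h : p a * Real.log (p a / pθ a) ≤ D + 1 / Real.exp 1 := by linarith
      rcases le_total (Real.log (p a / pθ a)) 0 with h0 | h0
      · exact h0.trans (by positivity)
      · nlinarith
    have hlogp : -Real.log (p a) ≤ Real.log k := by
      have h := Real.log_nonneg hpa
      rw [Real.log_mul (by linarith) hpa0.ne'] at h
      linarith
    have hlogk := Real.log_nonneg hk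
    have hlogn : 0 ≤ Real.log n := Real.log_natCast_nonneg n
    have hδmul : δ * (Real.log (p a / pθ a) - Real.log (p a) + Real.log n) ≤
        (k - 1) / n * (k * (D + 1 / Real.exp 1) + Real.log k + Real.log n) := by
      calc _ ≤ δ * (k * (D + 1 / Real.exp 1) + Real.log k + Real.log n) := by
            gcongr
            linarith
        _ ≤ _ := by gcongr
    have hc := div_le_div_of_nonneg_right (card_log_bound hk hkn) hnR.le
    have hkD : 0 ≤ k * D / n := by positivity
    have hid : (1 + k ^ 2 / n) * D +
        k / n * (2 * Real.log (n / 2) + Real.log k + k / Real.exp 1) -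
        (D + (k - 1) / n * (k * (D + 1 / Real.exp 1) + Real.log k + Real.log n) + (k - 1) / n) =
        k * D / n + ((2 * k * Real.log (n / 2) + Real.log k + k / Real.exp 1) / n -
          (k - 1) * (Real.log n + 1) / n) := by ring
    linarith
end

section
/- Let X be a measurable space, Θ a nonempty type, {Pθ}_{θ∈Θ} a family of probability measures on X, P0 a probability measure on X, and ε ≥ 0 such that there exists θ ∈ Θ with tv(P0, Pθ) ≤ ε. Define I_ε(θ) = inf { KL(Q|Pθ) : Q a probability measure with tv(Q, P0) ≤ ε }. Let x_1, x_2, … be i.i.d. with law P0 (distributed according to the infinite product measure P0^{⊗∞}). Suppose for each n we are given measurable maps Î_n from samples to functions Θ → ℝ and measurable estimators θ̂_n from samples to Θ such that (i) sup_{θ∈Θ} | Î_n(θ) − I_ε(θ) | → 0 in probability, and (ii) | Î_n(θ̂_n) − inf_{θ∈Θ} Î_n(θ) | → 0 in probability, where the compositions tv(P_{θ̂_n}, P0) with the sample are assumed measurable. Then max( tv(P_{θ̂_n}, P0) − ε, 0 ) → 0 in probability as n → ∞; equivalently, for every δ > 0, the probability that tv(P_{θ̂_n}, P0) > ε + δ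 tends to 0. -/
open MeasureTheory ENNReal Filter Topology
open scoped Classical

/-- Total variation distance between measures: `tv(P, Q) = sup_A |P(A) − Q(A)|` over
measurable sets `A`. -/
noncomputable def tvMeas {X : Type*} [MeasurableSpace X] (P Q : Measure X) : ℝ :=
  ⨆ A : {s : Set X // MeasurableSet s}, |(P A).toReal - (Q A).toReal|

/-- The total-variation OKL: `I_ε(θ) = inf { KL(Q|Pθ) : tv(Q, P0) ≤ ε }`. -/
noncomputable def OKLtv {X : Type*} [MeasurableSpace X] (P0 Pθ : Measure X)
    (ε : ℝ) : ℝ≥0∞ :=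
  ⨅ Q ∈ {Q : Measure X | IsProbabilityMeasure Q ∧ tvMeas Q P0 ≤ ε}, KLdiv Q Pθ

theorem mul_add_sub_exp_le_mul_log {r : ℝ} (hr : 0 ≤ r) (c : ℝ) :
    r * c + r - Real.exp c ≤ r * Real.log r := by
  rcases hr.eq_or_lt with rfl | hr
  · simpa using (Real.exp_pos c).le
  · have h := mul_le_mul_of_nonneg_left (Real.add_one_le_exp (c - Real.log r)) hr.le
    rw [Real.exp_sub, Real.exp_log hr, mul_div_cancel₀ _ hr.ne'] at h
    linarith

/-- Linearized Donsker–Varadhan inequality for the function `t • 𝟙_A`. -/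
theorem mul_measureReal_sub_le_integral_log {X : Type*} [MeasurableSpace X] {Q P : Measure X}
    [IsProbabilityMeasure Q] [IsProbabilityMeasure P] (hQP : Q ≪ P)
    (hint : Integrable (fun x => Real.log (Q.rnDeriv P x).toReal) Q)
    {A : Set X} (hA : MeasurableSet A) (t : ℝ) :
    t * Q.real A - (Real.exp t - 1) * P.real A ≤
      ∫ x, Real.log (Q.rnDeriv P x).toReal ∂Q := by
  have hr : Integrable (fun x => (Q.rnDeriv P x).toReal) P := Measure.integrable_toReal_rnDeriv
  have hrA : Integrable (fun x => t * A.indicator (fun x => (Q.rnDeriv P x).toReal) x) P :=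
    (hr.indicator hA).const_mul t
  have hc : Integrable (fun x => (Real.exp t - 1) * A.indicator (fun _ => (1 : ℝ)) x) P :=
    ((integrable_const (1 : ℝ)).indicator hA).const_mul _
  have hlog : Integrable
      (fun x => (Q.rnDeriv P x).toReal * Real.log (Q.rnDeriv P x).toReal) P :=
    (integrable_rnDeriv_mul_log_iff hQP).2 hint
  have hrA' : ∫ x, t * A.indicator (fun x => (Q.rnDeriv P x).toReal) x ∂P = t * Q.real A := by
    rw [integral_const_mul, integral_indicator hA, Measure.setIntegral_toReal_rnDeriv hQP]
  have hc' : ∫ x, (Real.exp t - 1) * A.indicator (fun _ => (1 : ℝ)) x ∂P =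
      (Real.exp t - 1) * P.real A := by
    rw [integral_const_mul, integral_indicator hA]
    simp
  have hmono : ∫ x, (t * A.indicator (fun x => (Q.rnDeriv P x).toReal) x
        + (Q.rnDeriv P x).toReal
        - ((Real.exp t - 1) * A.indicator (fun _ => (1 : ℝ)) x + 1)) ∂P
      ≤ ∫ x, (Q.rnDeriv P x).toReal * Real.log (Q.rnDeriv P x).toReal ∂P := by
    refine integral_mono ((hrA.add hr).sub (hc.add (integrable_const 1))) hlog fun x => ?_
    by_cases hx : x ∈ A
    · have := mul_add_sub_exp_le_mul_log (r := (Q.rnDeriv P x).toReal) ENNReal.toReal_nonneg t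
      simp only [Set.indicator_of_mem hx]
      linarith
    · have := mul_add_sub_exp_le_mul_log (r := (Q.rnDeriv P x).toReal) ENNReal.toReal_nonneg 0
      simp only [Set.indicator_of_notMem hx]
      simp only [Real.exp_zero] at this
      linarith
  have hsub := integral_sub (hrA.add hr) (hc.add (integrable_const 1))
  simp only [Pi.add_apply] at hsub
  rw [hsub, integral_add hrA hr, integral_add hc (integrable_const 1), hrA', hc', Measure.integral_toReal_rnDeriv hQP,
    integral_rnDeriv_mul_log hQP] at hmono
  simp only [integral_const, probReal_univ, smul_eq_mul, mul_one, llr_def] at hmono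
  linarith

/-- A Pinsker-type bound: a small Kullback–Leibler divergence controls the difference of the
measures on every measurable set. -/
theorem abs_measureReal_sub_le_of_KLdiv_lt {X : Type*} [MeasurableSpace X] {Q P : Measure X}
    [IsProbabilityMeasure Q] [IsProbabilityMeasure P] {t : ℝ} (ht : 0 < t) (ht1 : t ≤ 1)
    (hKL : KLdiv Q P < ENNReal.ofReal (t ^ 2)) {A : Set X} (hA : MeasurableSet A) :
    |Q.real A - P.real A| ≤ 2 * t := by
  unfold KLdiv at hKL
  split_ifs at hKL with h
  · have hK := (ENNReal.ofReal_lt_ofReal_iff (by positivity)).1 hKL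
    have hexp : Real.exp t - 1 ≤ t + t ^ 2 := by
      have := (abs_le.1 (Real.abs_exp_sub_one_sub_id_le (abs_le.2 ⟨by linarith, ht1⟩))).2
      linarith
    have key : ∀ B : Set X, MeasurableSet B → Q.real B - P.real B ≤ 2 * t := by
      intro B hB
      have h1 := mul_measureReal_sub_le_integral_log h.1 h.2 hB t
      have h2 := mul_le_mul_of_nonneg_right hexp (measureReal_nonneg (μ := P) (s := B))
      have h3 : P.real B ≤ 1 := measureReal_le_one
      have h4 : t * (Q.real B - P.real B) ≤ t * (2 * t) := by nlinarith [sq_nonneg t]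
      exact le_of_mul_le_mul_left h4 ht
    have h1 := key A hA
    have h2 := key Aᶜ hA.compl
    rw [probReal_compl_eq_one_sub hA, probReal_compl_eq_one_sub hA] at h2
    exact abs_le.2 ⟨by linarith, h1⟩
  · exact absurd hKL not_top_lt

theorem tvMeas_comm {X : Type*} [MeasurableSpace X] (P Q : Measure X) :
    tvMeas P Q = tvMeas Q P := by
  unfold tvMeas
  simp_rw [abs_sub_comm]

theorem abs_measureReal_sub_le_tvMeas {X : Type*} [MeasurableSpace X] (P Q : Measure X)
    [IsProbabilityMeasure P] [IsProbabilityMeasure Q] {A : Set X} (hA : MeasurableSet A) :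
    |P.real A - Q.real A| ≤ tvMeas P Q := by
  refine le_ciSup (f := fun A : {s : Set X // MeasurableSet s} =>
    |(P A).toReal - (Q A).toReal|) ⟨1, ?_⟩ ⟨A, hA⟩
  rintro _ ⟨B, rfl⟩
  have h1 : P.real B ≤ 1 := measureReal_le_one
  have h2 : Q.real B ≤ 1 := measureReal_le_one
  have h3 : 0 ≤ P.real B := measureReal_nonneg
  have h4 : 0 ≤ Q.real B := measureReal_nonneg
  change |P.real B - Q.real B| ≤ 1
  exact abs_le.2 ⟨by linarith, by linarith⟩

theorem KLdiv_self {X : Type*} [MeasurableSpace X] (P : Measure X) [SigmaFinite P] :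
    KLdiv P P = 0 := by
  have h : (fun x => Real.log (P.rnDeriv P x).toReal) =ᵐ[P] 0 := llr_self P
  have hint : Integrable (fun x => Real.log (P.rnDeriv P x).toReal) P :=
    (integrable_zero X ℝ P).congr h.symm
  simp [KLdiv, hint, Measure.AbsolutelyContinuous.rfl, integral_congr_ae h]

theorem OKLtv_eq_zero {X : Type*} [MeasurableSpace X] {P0 P : Measure X}
    [IsProbabilityMeasure P] {ε : ℝ} (h : tvMeas P0 P ≤ ε) : OKLtv P0 P ε = 0 := by
  refine le_antisymm ?_ zero_le
  rw [← KLdiv_self P]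
  exact iInf₂_le P ⟨inferInstance, tvMeas_comm P P0 ▸ h⟩

theorem tvMeas_le_of_OKLtv_lt {X : Type*} [MeasurableSpace X] {P0 P : Measure X}
    [IsProbabilityMeasure P0] [IsProbabilityMeasure P] {ε t : ℝ} (ht : 0 < t) (ht1 : t ≤ 1)
    (h : OKLtv P0 P ε < ENNReal.ofReal (t ^ 2)) : tvMeas P P0 ≤ ε + 2 * t := by
  simp only [OKLtv, iInf_lt_iff] at h
  obtain ⟨Q, ⟨hQ, hQ0⟩, hKL⟩ := h
  have : Nonempty {s : Set X // MeasurableSet s} := ⟨⟨∅, MeasurableSet.empty⟩⟩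
  refine ciSup_le fun A => ?_
  have h1 := abs_measureReal_sub_le_of_KLdiv_lt ht ht1 hKL A.2
  have h2 := (abs_measureReal_sub_le_tvMeas Q P0 A.2).trans hQ0
  rw [abs_sub_comm] at h1
  have h3 := abs_sub_le (P.real A) (Q.real A) (P0.real A)
  change |P.real A - P0.real A| ≤ _
  linarith

/-- Consistency of OWL estimators: under Assumption 1 (`∃ θ, tv(P0, Pθ) ≤ ε`), uniform
convergence in probability of the OKL estimator, and near-minimization by `θ̂_n`, the
estimated model satisfies `max(tv(P_{θ̂_n}, P0) − ε, 0) → 0` in probability. -/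
theorem stmt14 {X : Type*} [MeasurableSpace X] {Θ : Type*} [Nonempty Θ]
    (P : Θ → Measure X) (hP : ∀ θ, IsProbabilityMeasure (P θ))
    (P0 : Measure X) [IsProbabilityMeasure P0]
    (ε : ℝ) (hε : 0 ≤ ε) (hmis : ∃ θ, tvMeas P0 (P θ) ≤ ε)
    (Ihat : ∀ n : ℕ, (Fin n → X) → Θ → ℝ)
    (that : ∀ n : ℕ, (Fin n → X) → Θ)
    (hunif : ∀ δ : ℝ, 0 < δ →
      Tendsto (fun n : ℕ => (Measure.pi fun _ : Fin n => P0)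
        {x : Fin n → X | ∃ θ : Θ, OKLtv P0 (P θ) ε = ⊤ ∨
          δ < |Ihat n x θ - (OKLtv P0 (P θ) ε).toReal|}) atTop (𝓝 0))
    (hmin : ∀ δ : ℝ, 0 < δ →
      Tendsto (fun n : ℕ => (Measure.pi fun _ : Fin n => P0)
        {x : Fin n → X | δ < |Ihat n x (that n x) - ⨅ θ : Θ, Ihat n x θ|})
        atTop (𝓝 0)) :
    ∀ δ : ℝ, 0 < δ →
      Tendsto (fun n : ℕ => (Measure.pi fun _ : Fin n => P0)
        {x : Fin n → X | ε + δ < tvMeas (P (that n x)) P0}) atTop (𝓝 0) := by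
  intro δ hδ
  obtain ⟨θ₀, hθ₀⟩ := hmis
  set t : ℝ := min 1 (δ / 2)
  have ht : 0 < t := lt_min one_pos (by linarith)
  have ht1 : t ≤ 1 := min_le_left _ _
  have htδ : t ≤ δ / 2 := min_le_right _ _
  have hη : 0 < t ^ 2 / 4 := by positivity
  have hsum := (hunif _ hη).add (hmin _ hη)
  rw [add_zero] at hsum
  refine tendsto_of_tendsto_of_tendsto_of_le_of_le tendsto_const_nhds hsum
    (fun _ => zero_le) fun n => (measure_mono fun x hx => ?_).trans (measure_union_le _ _)
  by_contra hgood
  simp only [Set.mem_union, Set.mem_ofPred_eq, not_or, not_exists, not_lt] at hgood hx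
  obtain ⟨hI, hM⟩ := hgood
  have hbdd : BddBelow (Set.range (Ihat n x)) := by
    refine ⟨-(t ^ 2 / 4), ?_⟩
    rintro _ ⟨θ, rfl⟩
    have h1 := (abs_le.1 (hI θ).2).1
    have h2 : 0 ≤ (OKLtv P0 (P θ) ε).toReal := ENNReal.toReal_nonneg
    linarith
  have h0 := (abs_le.1 (hI θ₀).2).2
  rw [OKLtv_eq_zero hθ₀, ENNReal.toReal_zero] at h0
  have hinf := ciInf_le hbdd θ₀
  have hthat := (abs_le.1 (hI (that n x)).2).1
  have hM' := (abs_le.1 hM).2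
  have hlt : OKLtv P0 (P (that n x)) ε < ENNReal.ofReal (t ^ 2) :=
    (ENNReal.lt_ofReal_iff_toReal_lt (hI (that n x)).1).2 (by linarith)
  have := tvMeas_le_of_OKLtv_lt ht ht1 hlt
  linarith
end

section
/- Fix a dimension d ≥ 1 and let κ : [0,∞) → [0,∞) be a non-increasing continuous function such that ∫_{ℝ^d} κ(‖x‖₂) dx = 1, and such that there exist constants t₀ ≥ 1, C_ρ > 0 and 0 < ρ ≤ 1 with κ(t) ≤ C_ρ exp(−t^ρ) for all t > t₀. Set a = (d+1)/ρ, t₁ = max( Γ(a+1)^{1/(ρ(a−1))}, t₀ ), v_d = π^{d/2}/Γ(d/2 + 1), and C₁ = ρ^{−1} C_ρ v_d 2^{a−1}. Then for every t ≥ t₁, ∫_{{x ∈ ℝ^d : ‖x‖₂ ≥ t}} κ(‖x‖₂) dx ≤ C₁ · t^{d+1−ρ} · e^{−t^ρ}. -/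
open MeasureTheory ENNReal
open scoped BigOperators

theorem Real.add_rpow_le_two_rpow_mul {p x y : ℝ} (hp : 1 ≤ p) (hx : 0 ≤ x) (hy : 0 ≤ y) :
    (x + y) ^ p ≤ 2 ^ (p - 1) * (x ^ p + y ^ p) := by
  lift x to NNReal using hx
  lift y to NNReal using hy
  exact_mod_cast NNReal.rpow_add_le_mul_rpow_add_rpow x y hp

/-- Bounding the Gamma integral from below by its part over `(y, ∞)`. -/
theorem Real.rpow_mul_exp_neg_le_Gamma_add_one {a y : ℝ} (ha : 0 ≤ a) (hy : 0 ≤ y) :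
    y ^ a * Real.exp (-y) ≤ Real.Gamma (a + 1) := by
  have hint := Real.GammaIntegral_convergent (s := a + 1) (by linarith)
  rw [Real.Gamma_eq_integral (by linarith), ← integral_exp_neg_Ioi, ← integral_const_mul]
  simp only [add_sub_cancel_right] at hint ⊢
  have hsub : Set.Ioi y ⊆ Set.Ioi 0 := Set.Ioi_subset_Ioi hy
  calc ∫ s in Set.Ioi y, y ^ a * Real.exp (-s)
      ≤ ∫ s in Set.Ioi y, Real.exp (-s) * s ^ a := by
        refine setIntegral_mono_on ?_ (hint.mono_set hsub) measurableSet_Ioi fun s hs => ?_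
        · exact (integrableOn_exp_neg_Ioi y).const_mul _
        · rw [mul_comm]
          gcongr
          exact (Set.mem_Ioi.1 hs).le
    _ ≤ _ := by
        refine setIntegral_mono_set hint ?_ hsub.eventuallyLE
        filter_upwards [ae_restrict_mem measurableSet_Ioi] with s hs
        have : (0 : ℝ) < s := hs
        positivity

/-- A bound for the upper incomplete Gamma function, given a quasi-subadditivity constant `K`. -/
theorem setIntegral_exp_neg_mul_rpow_le {b x K : ℝ} (hb : 0 < b) (hx : 0 ≤ x)
    (hK : ∀ y, 0 ≤ y → (x + y) ^ (b - 1) ≤ K * (x ^ (b - 1) + y ^ (b - 1))) :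
    ∫ s in Set.Ioi x, Real.exp (-s) * s ^ (b - 1) ≤
      K * Real.exp (-x) * (x ^ (b - 1) + Real.Gamma b) := by
  have hint := Real.GammaIntegral_convergent hb
  have hemb := measurableEmbedding_addRight x
  have hmp := measurePreserving_add_right (volume : Measure ℝ) x
  have hpre : (fun y => y + x) ⁻¹' Set.Ioi x = Set.Ioi 0 := by ext; simp
  have hshift := hmp.setIntegral_preimage_emb hemb
    (fun s => Real.exp (-s) * s ^ (b - 1)) (Set.Ioi x)
  have hshift_int := (hmp.integrableOn_comp_preimage hemb
    (f := fun s => Real.exp (-s) * s ^ (b - 1)) (s := Set.Ioi x)).2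
      (hint.mono_set (Set.Ioi_subset_Ioi hx))
  rw [hpre] at hshift hshift_int
  have hexp : IntegrableOn (fun y => Real.exp (-y) * x ^ (b - 1)) (Set.Ioi 0) :=
    (integrableOn_exp_neg_Ioi 0).mul_const _
  rw [← hshift]
  calc ∫ y in Set.Ioi 0, Real.exp (-(y + x)) * (y + x) ^ (b - 1)
      ≤ ∫ y in Set.Ioi 0, K * Real.exp (-x) *
          (Real.exp (-y) * x ^ (b - 1) + Real.exp (-y) * y ^ (b - 1)) := by
        refine setIntegral_mono_on hshift_int ((hexp.add hint).const_mul _) measurableSet_Ioi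
          fun y hy => ?_
        rw [neg_add, Real.exp_add, add_comm y x]
        calc _ ≤ Real.exp (-y) * Real.exp (-x) * (K * (x ^ (b - 1) + y ^ (b - 1))) := by
              gcongr
              exact hK y (le_of_lt hy)
          _ = _ := by ring
    _ = _ := by
        rw [integral_const_mul, integral_add hexp hint, integral_mul_const,
          integral_exp_neg_Ioi_zero, Real.Gamma_eq_integral hb, one_mul]

theorem setIntegral_pow_mul_exp_neg_rpow {d : ℕ} (hd : 1 ≤ d) {ρ t : ℝ} (hρ : 0 < ρ)
    (ht : 0 ≤ t) :
    ∫ r in Set.Ioi t, r ^ (d - 1) * Real.exp (-(r ^ ρ)) =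
      ρ⁻¹ * ∫ s in Set.Ioi (t ^ ρ), Real.exp (-s) * s ^ ((d : ℝ) / ρ - 1) := by
  rw [← integral_comp_rpow_Ioi_of_pos' (c := t ^ ρ) hρ (by positivity),
    Real.rpow_rpow_inv ht hρ.ne', ← integral_const_mul]
  refine setIntegral_congr_fun measurableSet_Ioi fun r hr => ?_
  have hr : 0 < r := ht.trans_lt hr
  have h1 : r ^ (d - 1) = r ^ (ρ - 1) * r ^ (ρ * ((d : ℝ) / ρ - 1)) := by
    rw [← Real.rpow_add hr, ← Real.rpow_natCast]
    congr 1
    push_cast [hd]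
    field_simp
    ring
  simp only [smul_eq_mul]
  rw [← Real.rpow_mul hr.le, h1]
  field_simp

/-- The tail integral of a radial function in polar coordinates. -/
theorem lintegral_norm_ge_exp_neg_rpow {d : ℕ} (hd : 1 ≤ d) {ρ t C : ℝ} (hρ : 0 < ρ)
    (ht : 0 ≤ t) (hC : 0 ≤ C) :
    ∫⁻ x : EuclideanSpace ℝ (Fin d) in {x | t < ‖x‖},
        ENNReal.ofReal (C * Real.exp (-(‖x‖ ^ ρ))) =
      ENNReal.ofReal (d * (Real.pi ^ ((d : ℝ) / 2) / Real.Gamma ((d : ℝ) / 2 + 1)) *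
        (C * ∫ r in Set.Ioi t, r ^ (d - 1) * Real.exp (-(r ^ ρ)))) := by
  have : Nonempty (Fin d) := ⟨⟨0, hd⟩⟩
  have hS : MeasurableSet {x : EuclideanSpace ℝ (Fin d) | t < ‖x‖} :=
    measurableSet_lt measurable_const measurable_norm
  set F : ℝ → ℝ := (Set.Ioi t).indicator fun r => C * Real.exp (-(r ^ ρ)) with hF
  have hF0 : ∀ r, 0 ≤ F r := Set.indicator_nonneg fun r _ => by positivity
  have hpolar : ∀ r : ℝ, r ^ (d - 1) • F r =
      (Set.Ioi t).indicator (fun r => C * (r ^ (d - 1) * Real.exp (-(r ^ ρ)))) r := by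
    intro r
    by_cases h : t < r <;> simp [hF, h]
    ring
  have hint : IntegrableOn (fun r : ℝ => r ^ (d - 1) * Real.exp (-(r ^ ρ))) (Set.Ioi 0) := by
    have := integrableOn_rpow_mul_exp_neg_rpow (s := ((d - 1 : ℕ) : ℝ)) (p := ρ)
      (by linarith [(d - 1).cast_nonneg (α := ℝ)]) hρ
    simpa only [Real.rpow_natCast] using this
  have hFint : Integrable (fun x : EuclideanSpace ℝ (Fin d) => F ‖x‖) := by
    rw [integrable_fun_norm_addHaar, finrank_euclideanSpace_fin]
    simp only [hpolar]
    exact (hint.const_mul C).indicator measurableSet_Ioi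
  have hball : (volume : Measure (EuclideanSpace ℝ (Fin d))).real (Metric.ball 0 1) =
      Real.pi ^ ((d : ℝ) / 2) / Real.Gamma ((d : ℝ) / 2 + 1) := by
    rw [Measure.real, EuclideanSpace.volume_ball, Fintype.card_fin, ENNReal.ofReal_one, one_pow,
      one_mul, ENNReal.toReal_ofReal, Real.sqrt_eq_rpow, ← Real.rpow_mul_natCast Real.pi_pos.le]
    · congr 2
      ring
    · have := Real.Gamma_pos_of_pos (s := (d : ℝ) / 2 + 1) (by positivity)
      positivity
  have hlhs : ∫⁻ x : EuclideanSpace ℝ (Fin d) in {x | t < ‖x‖},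
        ENNReal.ofReal (C * Real.exp (-(‖x‖ ^ ρ))) =
      ∫⁻ x : EuclideanSpace ℝ (Fin d), ENNReal.ofReal (F ‖x‖) := by
    rw [← lintegral_indicator hS]
    refine lintegral_congr fun x => ?_
    by_cases h : t < ‖x‖ <;> simp [hF, h]
  rw [hlhs, ← ofReal_integral_eq_lintegral_ofReal hFint (.of_forall fun x => hF0 _),
    integral_fun_norm_addHaar, finrank_euclideanSpace_fin, hball]
  simp only [hpolar]
  rw [setIntegral_indicator measurableSet_Ioi, Set.inter_eq_right.2 (Set.Ioi_subset_Ioi ht),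
    integral_const_mul, nsmul_eq_mul, smul_eq_mul, mul_assoc (d : ℝ)]

/-- The quasi-subadditivity constant of `s ↦ s ^ (b - 1)`, `b = d / ρ`, can be chosen small
compared with `2 ^ (a - 1)`, `a = (d + 1) / ρ`. -/
theorem exists_rpow_add_le_mul {d : ℕ} (hd : 1 ≤ d) {ρ t x : ℝ} (hρ0 : 0 < ρ) (hρ1 : ρ ≤ 1)
    (ht : 1 ≤ t) (hdt : d ≤ 3 * t) (hx : 0 ≤ x) :
    ∃ K : ℝ, 0 ≤ K ∧ K * (d + t) ≤ 2 ^ (((d : ℝ) + 1) / ρ - 1) * t ∧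
      ∀ y, 0 ≤ y → (x + y) ^ ((d : ℝ) / ρ - 1) ≤
        K * (x ^ ((d : ℝ) / ρ - 1) + y ^ ((d : ℝ) / ρ - 1)) := by
  have hd' : (1 : ℝ) ≤ d := by exact_mod_cast hd
  have hdρ : (d : ℝ) ≤ d / ρ := le_div_self (by positivity) hρ0 hρ1
  have hinv : 1 ≤ 1 / ρ := (one_le_div hρ0).2 hρ1
  have hsplit : ((d : ℝ) + 1) / ρ = d / ρ + 1 / ρ := add_div _ _ _
  rcases le_or_gt 2 ((d : ℝ) / ρ) with hb | hb
  · refine ⟨2 ^ ((d : ℝ) / ρ - 1 - 1), by positivity, ?_,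
      fun y hy => Real.add_rpow_le_two_rpow_mul (by linarith) hx hy⟩
    have h4 : (2 : ℝ) ^ ((d : ℝ) / ρ - 1 - 1) * 4 ≤ 2 ^ (((d : ℝ) + 1) / ρ - 1) := by
      rw [show (4 : ℝ) = 2 ^ (2 : ℝ) by norm_num, ← Real.rpow_add two_pos]
      exact Real.rpow_le_rpow_of_exponent_le one_le_two (by linarith)
    have h0 : (0 : ℝ) ≤ 2 ^ ((d : ℝ) / ρ - 1 - 1) := by positivity
    nlinarith
  · refine ⟨1, zero_le_one, ?_, fun y hy => ?_⟩
    · have h2 : (2 : ℝ) ≤ 2 ^ (((d : ℝ) + 1) / ρ - 1) := by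
        nth_rewrite 1 [← Real.rpow_one 2]
        exact Real.rpow_le_rpow_of_exponent_le one_le_two (by linarith)
      have hd1 : (d : ℝ) = 1 := by
        have : d < 2 := by exact_mod_cast hdρ.trans_lt hb
        exact_mod_cast (by omega : d = 1)
      nlinarith
    · rw [one_mul]
      exact Real.rpow_add_le_add_rpow hx hy (by linarith) (by linarith)

/-- Tail bound for radial probability kernels with exponentially decaying profile:
for `t ≥ t₁`, `∫_{‖x‖ ≥ t} κ(‖x‖) dx ≤ C₁ t^{d+1−ρ} e^{−t^ρ}`. -/
theorem stmt15 (d : ℕ) (hd : 1 ≤ d) (κ : ℝ → ℝ)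
    (hκ0 : ∀ t : ℝ, 0 ≤ t → 0 ≤ κ t)
    (hmono : AntitoneOn κ (Set.Ici 0))
    (hcont : ContinuousOn κ (Set.Ici 0))
    (hnorm : ∫⁻ x : EuclideanSpace ℝ (Fin d), ENNReal.ofReal (κ ‖x‖) = 1)
    (t0 Cρ ρ : ℝ) (ht0 : 1 ≤ t0) (hCρ : 0 < Cρ) (hρ0 : 0 < ρ) (hρ1 : ρ ≤ 1)
    (htail : ∀ t : ℝ, t0 < t → κ t ≤ Cρ * Real.exp (-(t ^ ρ)))
    (a t1 vd C1 : ℝ)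
    (ha : a = ((d : ℝ) + 1) / ρ)
    (ht1 : t1 = max ((Real.Gamma (a + 1)) ^ (1 / (ρ * (a - 1)))) t0)
    (hvd : vd = Real.pi ^ ((d : ℝ) / 2) / Real.Gamma ((d : ℝ) / 2 + 1))
    (hC1 : C1 = ρ⁻¹ * Cρ * vd * (2 : ℝ) ^ (a - 1)) :
    ∀ t : ℝ, t1 ≤ t →
      (∫⁻ x : EuclideanSpace ℝ (Fin d) in {x | t ≤ ‖x‖}, ENNReal.ofReal (κ ‖x‖)) ≤
        ENNReal.ofReal (C1 * t ^ ((d : ℝ) + 1 - ρ) * Real.exp (-(t ^ ρ))) := by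
  intro t htt
  have hd' : (1 : ℝ) ≤ d := by exact_mod_cast hd
  have hdρ : (d : ℝ) ≤ d / ρ := le_div_self (by positivity) hρ0 hρ1
  have hinv : 1 ≤ 1 / ρ := (one_le_div hρ0).2 hρ1
  have hab : a = d / ρ + 1 / ρ := ha.trans (add_div _ _ _)
  have ht0t : t0 ≤ t := (le_max_right _ _).trans (ht1 ▸ htt)
  have ht : 1 ≤ t := ht0.trans ht0t
  have htpos : 0 < t := by linarith
  have hxt : t ^ ρ ≤ t := by simpa using Real.rpow_le_rpow_of_exponent_le ht hρ1
  have hΓpos : 0 < Real.Gamma (a + 1) := Real.Gamma_pos_of_pos (by linarith)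
  have hpow : (t ^ ρ) ^ (a - 1) = t ^ ((d : ℝ) + 1 - ρ) := by
    rw [← Real.rpow_mul htpos.le]
    congr 1
    rw [ha]
    field_simp
  have hpow' : (t ^ ρ) ^ ((d : ℝ) / ρ - 1) * t = t ^ ((d : ℝ) + 1 - ρ) := by
    rw [← Real.rpow_mul htpos.le, ← Real.rpow_add_one htpos.ne']
    congr 1
    field_simp
    ring
  have hΓx : Real.Gamma (a + 1) ≤ (t ^ ρ) ^ (a - 1) := by
    have h := (le_max_left _ _).trans (ht1 ▸ htt)
    rw [← Real.rpow_mul htpos.le]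
    rwa [one_div, Real.rpow_inv_le_iff_of_pos hΓpos.le htpos.le (by nlinarith)] at h
  have hdt : (d : ℝ) ≤ 3 * t := by
    have hlow : ((a - 1) / Real.exp 1) ^ (a - 1) ≤ (t ^ ρ) ^ (a - 1) := by
      refine le_trans ?_ ((Real.rpow_mul_exp_neg_le_Gamma_add_one (a := a) (y := a - 1)
        (by linarith) (by linarith)).trans hΓx)
      rw [Real.div_rpow (by linarith) (Real.exp_pos _).le, Real.exp_one_rpow, Real.exp_neg,
        ← div_eq_mul_inv]
      gcongr
      · linarith
      · linarith
    have h := (Real.rpow_le_rpow_iff (div_nonneg (by linarith) (Real.exp_pos _).le)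
      (by positivity) (by linarith)).1 hlow
    rw [div_le_iff₀ (Real.exp_pos _)] at h
    nlinarith [mul_le_mul hxt Real.exp_one_lt_d9.le (Real.exp_pos 1).le htpos.le]
  obtain ⟨K, hK0, hK, hKadd⟩ :=
    exists_rpow_add_le_mul hd hρ0 hρ1 ht hdt (x := t ^ ρ) (by positivity)
  rw [← ha] at hK
  have hb : 0 < (d : ℝ) / ρ := by positivity
  have hΓ : d * Real.Gamma ((d : ℝ) / ρ) ≤ t ^ ((d : ℝ) + 1 - ρ) := by
    have h1 : Real.Gamma ((d : ℝ) / ρ + 1) ≤ Real.Gamma (a + 1) :=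
      Real.Gamma_strictMonoOn_Ici.monotoneOn (Set.mem_Ici.2 (by linarith))
        (Set.mem_Ici.2 (by linarith)) (by linarith)
    rw [Real.Gamma_add_one hb.ne'] at h1
    rw [← hpow]
    refine le_trans ?_ (h1.trans hΓx)
    gcongr
  have hmain : d * ∫ s in Set.Ioi (t ^ ρ), Real.exp (-s) * s ^ ((d : ℝ) / ρ - 1) ≤
      2 ^ (a - 1) * t ^ ((d : ℝ) + 1 - ρ) * Real.exp (-(t ^ ρ)) := by
    set P := t ^ ((d : ℝ) + 1 - ρ) with hP
    have hP0 : 0 ≤ P := by positivity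
    have hxP : (t ^ ρ) ^ ((d : ℝ) / ρ - 1) = P / t := eq_div_of_mul_eq htpos.ne' hpow'
    calc _ ≤ d * (K * Real.exp (-(t ^ ρ)) *
            ((t ^ ρ) ^ ((d : ℝ) / ρ - 1) + Real.Gamma ((d : ℝ) / ρ))) := by
          gcongr
          exact setIntegral_exp_neg_mul_rpow_le hb (by positivity) hKadd
      _ = K * Real.exp (-(t ^ ρ)) * (d * (P / t) + d * Real.Gamma ((d : ℝ) / ρ)) := by
          rw [hxP]; ring
      _ ≤ K * Real.exp (-(t ^ ρ)) * (d * (P / t) + P) := by gcongr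
      _ = K * (d + t) / t * P * Real.exp (-(t ^ ρ)) := by field_simp
      _ ≤ _ := by
          gcongr
          rwa [div_le_iff₀ htpos]
  have hvd0 : 0 ≤ vd := by
    have := Real.Gamma_pos_of_pos (s := (d : ℝ) / 2 + 1) (by positivity)
    rw [hvd]
    positivity
  have : Nonempty (Fin d) := ⟨⟨0, hd⟩⟩
  have hae : {x : EuclideanSpace ℝ (Fin d) | t ≤ ‖x‖} =ᵐ[volume] {x | t < ‖x‖} := by
    have hsph := Measure.addHaar_sphere (volume : Measure (EuclideanSpace ℝ (Fin d))) 0 t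
    filter_upwards [compl_mem_ae_iff.2 hsph] with x hx
    have hx : ‖x‖ ≠ t := by simpa using hx
    exact propext ⟨fun h => lt_of_le_of_ne h hx.symm, fun h => le_of_lt h⟩
  calc _ = ∫⁻ x : EuclideanSpace ℝ (Fin d) in {x | t < ‖x‖}, ENNReal.ofReal (κ ‖x‖) :=
        setLIntegral_congr hae
    _ ≤ ∫⁻ x : EuclideanSpace ℝ (Fin d) in {x | t < ‖x‖},
          ENNReal.ofReal (Cρ * Real.exp (-(‖x‖ ^ ρ))) :=
        setLIntegral_mono' (measurableSet_lt measurable_const measurable_norm)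
          fun x hx => ENNReal.ofReal_le_ofReal (htail _ (ht0t.trans_lt hx))
    _ = _ := lintegral_norm_ge_exp_neg_rpow hd hρ0 htpos.le hCρ.le
    _ ≤ _ := by
        refine ENNReal.ofReal_le_ofReal ?_
        rw [← hvd, setIntegral_pow_mul_exp_neg_rpow hd hρ0 htpos.le, hC1]
        calc _ = ρ⁻¹ * Cρ * vd *
              (d * ∫ s in Set.Ioi (t ^ ρ), Real.exp (-s) * s ^ ((d : ℝ) / ρ - 1)) := by ring
          _ ≤ ρ⁻¹ * Cρ * vd *
              (2 ^ (a - 1) * t ^ ((d : ℝ) + 1 - ρ) * Real.exp (-(t ^ ρ))) := by gcongr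
          _ = _ := by ring
end
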